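/- arXiv:2102.13041 — 2 statements merged into one kernel-verified Lean document; each statement's English description precedes it below -/
import Mathlib

section
/- Let d ≥ 2 and s > 1, and let E ⊆ ℝ^d be a Lebesgue-measurable set of finite Lebesgue measure and finite perimeter. Then lim_{r→0⁺} J̃_r^s(E)/σ^s(r) = ω_{d−1}·Per(E). -/
open MeasureTheory Filter Set Metric
open scoped ENNReal NNReal symmDiff

noncomputable section

abbrev Euc (d : ℕ) : Type := EuclideanSpace ℝ (Fin d)

/-- The kernel `k^s_r`. -/
def ker (d : ℕ) (s r t : ℝ) : ℝ :=
  if t ≤ r then r ^ (-((d : ℝ) + s)) else t ^ (-((d : ℝ) + s))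

/-- The regularized `s`-fractional perimeter `J̃_r^s(E) = ∫_E ∫_{Eᶜ} k^s_r(|x-y|) dy dx`. -/
def Jt (d : ℕ) (s r : ℝ) (E : Set (Euc d)) : ℝ≥0∞ :=
  ∫⁻ x in E, ∫⁻ y in Eᶜ, ENNReal.ofReal (ker d s r (dist x y))

/-- The scaling factor `σ^s(r)`. -/
def sgm (d : ℕ) (s r : ℝ) : ℝ :=
  if s = 1 then |Real.log r| else (((d : ℝ) + s) / ((d : ℝ) + 1)) * r ^ (1 - s) / (s - 1)

/-- The scaling factor `β(r,s)` for the simultaneous limit. -/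
def betaScale (d : ℕ) (s r : ℝ) : ℝ :=
  (((d : ℝ) + s) / ((d : ℝ) + 1)) * ((r ^ (1 - s) - 1) / (s - 1)) + 1 / ((d : ℝ) + 1)

/-- `ω_k`: Lebesgue measure of the unit ball in `ℝ^k`. -/
def omegaB (k : ℕ) : ℝ := (volume (ball (0 : Euc k) 1)).toReal

/-- Divergence of a vector field on `ℝ^d`. -/
def diverg {d : ℕ} (Φ : Euc d → Euc d) (x : Euc d) : ℝ :=
  ∑ i : Fin d, fderiv ℝ Φ x (EuclideanSpace.single i 1) i

/-- De Giorgi perimeter. -/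
def Per (d : ℕ) (E : Set (Euc d)) : ℝ≥0∞ :=
  ⨆ (Φ : Euc d → Euc d) (_ : ContDiff ℝ 1 Φ) (_ : HasCompactSupport Φ)
    (_ : ∀ x, ‖Φ x‖ ≤ 1), ENNReal.ofReal (∫ x in E, diverg Φ x)

/-- The cube `lQ + ξ` where `Q = [-1/2, 1/2)^d`. -/
def cube (d : ℕ) (l : ℝ) (ξ : Euc d) : Set (Euc d) :=
  {x | ∀ i, x i ∈ Set.Ico (ξ i - l / 2) (ξ i + l / 2)}

/-- Half space `H⁻_ν(0)`. -/
def Hminus (d : ℕ) (ν : Euc d) : Set (Euc d) := {y | @inner ℝ _ _ ν y ≤ 0}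

/-- Standard (normalized) `k`-dimensional Hausdorff measure on `ℝ^d`:
Mathlib's `μH[k]` uses `diam^k` gauges without the normalizing constant `ω_k/2^k`. -/
def Hstd (d : ℕ) (k : ℕ) : Measure (Euc d) :=
  (ENNReal.ofReal (omegaB k / 2 ^ k)) • (μH[(k : ℝ)] : Measure (Euc d))

/-- The nonlocal `k^s_r`-curvature. -/
def curv (d : ℕ) (s r : ℝ) (E : Set (Euc d)) (x : Euc d) : ℝ :=
  ∫ y, (Set.indicator Eᶜ (fun _ => (1 : ℝ)) y - Set.indicator E (fun _ => (1 : ℝ)) y)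
    * ker d s r (dist x y)

/-- The class `𝔈`: closures of open sets with compact `C²` boundary. -/
def IsC2Domain (d : ℕ) (E : Set (Euc d)) : Prop :=
  ∃ U : Set (Euc d), IsOpen U ∧ E = closure U ∧ IsCompact (frontier U) ∧
    ∃ f : Euc d → ℝ, ContDiff ℝ 2 f ∧ U = {x | f x < 0} ∧ frontier U = {x | f x = 0} ∧
      ∀ x ∈ frontier U, fderiv ℝ f x ≠ 0




lemma aux_half (n : ℕ) : ∫ t in (0:ℝ)..1, t * √(1 - t^2) ^ n = 1 / (n + 2) := by
  have hd : ∀ t ∈ uIcc (0:ℝ) 1, HasDerivAt (fun t : ℝ => -(1 - t^2) ^ ((n:ℝ)/2 + 1) / (n + 2))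
      (t * √(1 - t^2) ^ n) t := by
    intro t ht
    rw [uIcc_of_le zero_le_one] at ht
    have h0 : 0 ≤ 1 - t^2 := by nlinarith [ht.1, ht.2]
    have h1 : HasDerivAt (fun t : ℝ => 1 - t^2) (-(2 * t)) t := by
      simpa using ((hasDerivAt_pow 2 t).const_sub 1)
    have h2 := (h1.rpow_const (p := (n:ℝ)/2 + 1) (Or.inr (by
      have : (0:ℝ) ≤ n := by positivity
      linarith))).neg.div_const ((n:ℝ) + 2)
    refine h2.congr_deriv ?_
    rw [add_sub_cancel_right, Real.rpow_div_two_eq_sqrt _ h0, Real.rpow_natCast]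
    field_simp
  rw [intervalIntegral.integral_eq_sub_of_hasDerivAt hd]
  · have : ((n:ℝ)/2 + 1) ≠ 0 := by positivity
    simp [Real.zero_rpow this]
    rw [neg_div, neg_neg, one_div]
  · apply Continuous.intervalIntegrable
    fun_prop

lemma aux_full (n : ℕ) : ∫ t in (-1:ℝ)..1, |t| * √(1 - t^2) ^ n = 2 / (n + 2) := by
  have hc : Continuous (fun t : ℝ => |t| * √(1 - t^2) ^ n) := by fun_prop
  have h1 : ∫ t in (0:ℝ)..1, |t| * √(1 - t^2) ^ n = 1 / (n + 2) := by
    rw [← aux_half n]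
    apply intervalIntegral.integral_congr
    intro t ht
    rw [uIcc_of_le zero_le_one] at ht
    simp [abs_of_nonneg ht.1]
  have h2 : ∫ t in (-1:ℝ)..0, |t| * √(1 - t^2) ^ n = 1 / (n + 2) := by
    rw [← h1]
    have := intervalIntegral.integral_comp_neg (a := (-1:ℝ)) (b := 0)
      (fun t : ℝ => |t| * √(1 - t^2) ^ n)
    simpa using this
  rw [← intervalIntegral.integral_add_adjacent_intervals (hc.intervalIntegrable (-1) 0)
    (hc.intervalIntegrable 0 1), h1, h2]
  ring

lemma aux_lint (n : ℕ) : ∫⁻ t in Ioo (-1:ℝ) 1, ENNReal.ofReal (|t| * √(1 - t^2) ^ n)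
    = ENNReal.ofReal (2 / (n + 2)) := by
  rw [← aux_full n, intervalIntegral.integral_of_le (by norm_num), integral_Ioc_eq_integral_Ioo,
    ofReal_integral_eq_lintegral_ofReal]
  · have hc : Continuous (fun t : ℝ => |t| * √(1 - t^2) ^ n) := by fun_prop
    exact (hc.integrableOn_Icc (a := -1) (b := 1)).mono_set Ioo_subset_Icc_self
  · exact Eventually.of_forall fun t => by positivity

lemma ball_slice (n : ℕ) (t : ℝ) :
    (volume {y : Fin n → ℝ | t^2 + ∑ i, (y i)^2 < 1})
      = volume (ball (0 : Euc n) (√(1 - t^2))) := by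
  rw [← (PiLp.volume_preserving_ofLp (Fin n)).measure_preimage]
  · congr 1
    ext y
    simp only [mem_preimage, mem_ofPred_eq, mem_ball_zero_iff]
    rw [Real.lt_sqrt (norm_nonneg _), EuclideanSpace.norm_sq_eq]
    simp only [Real.norm_eq_abs, sq_abs]
    constructor <;> intro h <;> linarith
  · apply MeasurableSet.nullMeasurableSet
    apply measurableSet_lt <;> fun_prop

lemma A_const (n : ℕ) : ∫⁻ z in ball (0:Euc (n+1)) 1, ‖z 0‖ₑ
    = ENNReal.ofReal (2 * omegaB n / (n + 2)) := by
  have hmp := (volume_preserving_piFinSuccAbove (fun _ : Fin (n+1) => ℝ) 0).comp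
    (PiLp.volume_preserving_ofLp (Fin (n+1)))
  set S : Set (ℝ × (Fin n → ℝ)) := {p | p.1^2 + ∑ i, (p.2 i)^2 < 1} with hS
  have hSm : MeasurableSet S := by
    apply measurableSet_lt <;> fun_prop
  have e1 : ∫⁻ z in ball (0:Euc (n+1)) 1, ‖z 0‖ₑ
      = ∫⁻ p : ℝ × (Fin n → ℝ), S.indicator (fun p => ‖p.1‖ₑ) p := by
    rw [← lintegral_indicator measurableSet_ball, ← hmp.lintegral_comp]
    · apply lintegral_congr
      intro z
      have : z ∈ ball (0:Euc (n+1)) 1 ↔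
        (MeasurableEquiv.piFinSuccAbove (fun _ : Fin (n+1) => ℝ) 0 ∘ WithLp.ofLp) z ∈ S := by
        rw [mem_ball_zero_iff, hS]
        simp only [mem_ofPred_eq, Function.comp]
        rw [← sq_lt_one_iff₀ (norm_nonneg _), EuclideanSpace.norm_sq_eq, Fin.sum_univ_succ]
        simp [Fin.tail]
      by_cases h : z ∈ ball (0:Euc (n+1)) 1
      · rw [indicator_of_mem h, indicator_of_mem (this.1 h)]
        simp
      · rw [indicator_of_notMem h, indicator_of_notMem (fun h' => h (this.2 h'))]
    · apply Measurable.indicator _ hSm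
      fun_prop
  rw [e1, Measure.volume_eq_prod, lintegral_prod _ (by
    apply Measurable.aemeasurable
    apply Measurable.indicator _ hSm
    fun_prop)]
  have e2 : ∀ t : ℝ, ∫⁻ y : Fin n → ℝ, S.indicator (fun p => ‖p.1‖ₑ) (t, y)
      = (Ioo (-1:ℝ) 1).indicator (fun t => ENNReal.ofReal (|t| * √(1 - t^2) ^ n)) t
        * ENNReal.ofReal (omegaB n) := by
    intro t
    have : ∀ y : Fin n → ℝ, S.indicator (fun p => ‖p.1‖ₑ) (t, y)
      = ({y : Fin n → ℝ | t^2 + ∑ i, (y i)^2 < 1}).indicator (fun _ => ‖t‖ₑ) y := by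
      intro y
      simp [indicator, hS]
    simp_rw [this]
    rw [lintegral_indicator_const (by apply measurableSet_lt <;> fun_prop), ball_slice]
    by_cases ht : t ∈ Ioo (-1:ℝ) 1
    · have hpos : 0 < √(1 - t^2) := Real.sqrt_pos.2 (by nlinarith [ht.1, ht.2])
      rw [indicator_of_mem ht, Measure.addHaar_ball_of_pos _ _ hpos, omegaB,
        ENNReal.ofReal_toReal measure_ball_lt_top.ne, ENNReal.ofReal_mul (abs_nonneg _),
        ← mul_assoc, Real.enorm_eq_ofReal_abs]
      simp
    · have : √(1 - t^2) = 0 := by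
        apply Real.sqrt_eq_zero_of_nonpos
        by_contra h
        apply ht
        have : |t| < 1 := by
          rw [← sq_lt_one_iff₀ (abs_nonneg _), sq_abs]; linarith
        exact abs_lt.1 this
      rw [indicator_of_notMem ht, this]
      simp
  simp_rw [e2]
  rw [lintegral_mul_const _ (by
    apply Measurable.indicator _ measurableSet_Ioo
    fun_prop), lintegral_indicator measurableSet_Ioo, aux_lint,
    ← ENNReal.ofReal_mul (by positivity)]
  congr 1
  ring

lemma ball_L (d : ℕ) (i : Fin d) (L : Euc d →L[ℝ] ℝ) : ∫⁻ z in ball (0:Euc d) 1, ‖L z‖ₑ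
    = ‖L‖ₑ * ∫⁻ z in ball (0:Euc d) 1, ‖z i‖ₑ := by
  obtain ⟨v, rfl⟩ := (InnerProductSpace.toDual ℝ (Euc d)).surjective L
  set w : Euc d := ‖v‖ • EuclideanSpace.single i 1 with hw
  have hn : ‖w‖ = ‖v‖ := by simp [hw, norm_smul]
  set g := Submodule.reflection (ℝ ∙ (w - v))ᗮ with hg
  have hgw : g w = v := Submodule.reflection_sub hn
  have h1 : ∀ z, inner ℝ v (g z) = ‖v‖ * z i := by
    intro z
    rw [← hgw, g.inner_map_map, hgw, hw, inner_smul_left]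
    simp [EuclideanSpace.inner_single_left]
  have := (LinearIsometryEquiv.measurePreserving g).setLIntegral_comp_preimage_emb
    g.toHomeomorph.measurableEmbedding (fun z => ‖InnerProductSpace.toDual ℝ (Euc d) v z‖ₑ)
    (ball 0 1)
  rw [← this]
  have hpre : g ⁻¹' (ball 0 1) = ball 0 1 := by
    ext z; simp
  rw [hpre, ← lintegral_const_mul _ (by fun_prop)]
  apply lintegral_congr
  intro z
  rw [InnerProductSpace.toDual_apply_apply, h1, enorm_mul]
  simp


lemma lint_scale (d : ℕ) (r : ℝ) (hr : 0 < r) (f : Euc d → ℝ≥0∞) (hf : Measurable f) :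
    ∫⁻ z, f z = ENNReal.ofReal (r ^ d) * ∫⁻ w, f (r • w) := by
  have h := Measure.map_addHaar_smul (volume : Measure (Euc d)) hr.ne'
  have h2 : ∫⁻ w, f (r • w) = ENNReal.ofReal |(r ^ d)⁻¹| * ∫⁻ z, f z := by
    rw [← lintegral_map hf (by fun_prop), h, lintegral_smul_measure]
    simp
  have hp : 0 < r ^ d := by positivity
  rw [h2, ← mul_assoc, abs_of_pos (by positivity), ← ENNReal.ofReal_mul hp.le,
    mul_inv_cancel₀ hp.ne']
  simp

lemma ball_scale (d : ℕ) (l : ℝ) (hl : 0 < l) (L : Euc d →L[ℝ] ℝ) :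
    ∫⁻ z in ball (0:Euc d) l, ‖L z‖ₑ
      = ENNReal.ofReal (l ^ (d+1)) * ∫⁻ z in ball (0:Euc d) 1, ‖L z‖ₑ := by
  have hLm : Measurable (fun z : Euc d => ‖L z‖ₑ) := L.continuous.measurable.enorm
  rw [← lintegral_indicator measurableSet_ball, ← lintegral_indicator measurableSet_ball,
    lint_scale d l hl _ (hLm.indicator measurableSet_ball), pow_succ,
    ENNReal.ofReal_mul (by positivity), mul_assoc]
  congr 1
  rw [← lintegral_const_mul' _ _ ENNReal.ofReal_ne_top]
  apply lintegral_congr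
  intro z
  have : l • z ∈ ball (0:Euc d) l ↔ z ∈ ball (0:Euc d) 1 := by
    rw [mem_ball_zero_iff, mem_ball_zero_iff, norm_smul, Real.norm_of_nonneg hl.le]
    constructor <;> intro h <;> nlinarith
  by_cases h : z ∈ ball (0:Euc d) 1
  · rw [indicator_of_mem h, indicator_of_mem (this.2 h), map_smul, enorm_smul,
      Real.enorm_of_nonneg hl.le]
  · rw [indicator_of_notMem h, indicator_of_notMem (fun h' => h (this.1 h'))]
    simp

lemma lint_rpow (p c : ℝ) (hp : 0 < p) (hc : 0 < c) :
    ∫⁻ l in Ioi c, ENNReal.ofReal (p * l ^ (-p - 1)) = ENNReal.ofReal (c ^ (-p)) := by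
  rw [← ofReal_integral_eq_lintegral_ofReal]
  · rw [integral_const_mul, integral_Ioi_rpow_of_lt (by linarith) hc]
    congr 1
    rw [sub_add_cancel]
    field_simp
  · exact (integrableOn_Ioi_rpow_of_lt (by linarith) hc).const_mul _
  · filter_upwards [ae_restrict_mem measurableSet_Ioi] with l hl
    have : 0 < l := hc.trans hl
    show 0 ≤ p * l ^ (-p - 1)
    positivity

lemma layer (d : ℕ) (s : ℝ) (hs : 1 < s) (z : Euc d) :
    ENNReal.ofReal (ker d s 1 ‖z‖) = ∫⁻ l in Ioi (1:ℝ),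
      ENNReal.ofReal ((d+s) * l ^ (-((d:ℝ)+s) - 1)) * (ball (0:Euc d) l).indicator 1 z := by
  have hp : 0 < (d:ℝ) + s := by positivity
  have h1 : ker d s 1 ‖z‖ = (max 1 ‖z‖) ^ (-((d:ℝ)+s)) := by
    unfold _root_.ker
    split_ifs with h
    · rw [max_eq_left h]
    · rw [max_eq_right (le_of_not_ge h)]
  rw [h1, ← lint_rpow _ _ hp (lt_max_of_lt_left one_pos), ← lintegral_indicator measurableSet_Ioi,
    ← lintegral_indicator measurableSet_Ioi]
  apply lintegral_congr
  intro l
  simp only [indicator, mem_Ioi, mem_ball_zero_iff, max_lt_iff, Pi.one_apply]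
  by_cases h1 : 1 < l <;> by_cases h2 : ‖z‖ < l <;> simp [h1, h2]

lemma K_const (n : ℕ) (s : ℝ) (hs : 1 < s) (L : Euc (n+1) →L[ℝ] ℝ) :
    ∫⁻ z, ENNReal.ofReal (ker (n+1) s 1 ‖z‖) * ‖L z‖ₑ
      = ENNReal.ofReal (2 * omegaB n * (((n+1 : ℕ):ℝ) + s) / ((((n+1 : ℕ):ℝ) + 1) * (s-1))) * ‖L‖ₑ := by
  have hd : (0:ℝ) ≤ ((n+1 : ℕ):ℝ) := by positivity
  generalize hdd : ((n+1 : ℕ):ℝ) = D at *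
  have hom : 0 ≤ omegaB n := ENNReal.toReal_nonneg
  have hmi : Measurable (fun q : Euc (n+1) × ℝ => (ball (0:Euc (n+1)) q.2).indicator (1 : Euc (n+1) → ℝ≥0∞) q.1) := by
    have : (fun q : Euc (n+1) × ℝ => (ball (0:Euc (n+1)) q.2).indicator (1 : Euc (n+1) → ℝ≥0∞) q.1)
      = ({q : Euc (n+1) × ℝ | ‖q.1‖ < q.2}).indicator 1 := by
      ext q; simp [indicator]
    rw [this]
    apply Measurable.indicator measurable_one
    apply measurableSet_lt <;> fun_prop
  have e1 : ∀ z : Euc (n+1), ENNReal.ofReal (ker (n+1) s 1 ‖z‖) * ‖L z‖ₑ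
      = ∫⁻ l in Ioi (1:ℝ), ENNReal.ofReal ((D+s) * l ^ (-(D+s) - 1)) *
        (ball (0:Euc (n+1)) l).indicator 1 z * ‖L z‖ₑ := by
    intro z
    rw [layer _ _ hs, lintegral_mul_const' _ _ enorm_ne_top, hdd]
  simp_rw [e1]
  rw [lintegral_lintegral_swap (by
    apply Measurable.aemeasurable
    have hLm : Measurable (fun z : Euc (n+1) => ‖L z‖ₑ) := L.continuous.measurable.enorm
    have hlm : Measurable (fun l : ℝ => ENNReal.ofReal ((D+s) * l ^ (-(D+s) - 1))) := by fun_prop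
    exact ((hlm.comp measurable_snd).mul hmi).mul (hLm.comp measurable_fst))]
  have e2 : ∀ l ∈ Ioi (1:ℝ), ∫⁻ z : Euc (n+1), ENNReal.ofReal ((D+s) * l ^ (-(D+s) - 1)) *
        (ball (0:Euc (n+1)) l).indicator 1 z * ‖L z‖ₑ
      = ENNReal.ofReal ((s-1) * l ^ (-(s-1) - 1)) *
        (ENNReal.ofReal (2 * omegaB n * (D + s) / ((D + 1) * (s-1))) * ‖L‖ₑ) := by
    intro l hl
    have hl0 : 0 < l := one_pos.trans hl
    simp_rw [mul_assoc]
    rw [lintegral_const_mul' _ _ ENNReal.ofReal_ne_top]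
    have : ∀ z, (ball (0:Euc (n+1)) l).indicator 1 z * ‖L z‖ₑ
      = (ball (0:Euc (n+1)) l).indicator (fun z => ‖L z‖ₑ) z := by
      intro z; simp [indicator]
    simp_rw [this]
    rw [lintegral_indicator measurableSet_ball, ball_scale _ _ hl0, ball_L _ 0, A_const,
      mul_comm ‖L‖ₑ]
    simp_rw [← mul_assoc]
    have hs1 : 0 < s - 1 := by linarith
    rw [← ENNReal.ofReal_mul (by positivity), ← ENNReal.ofReal_mul (by positivity),
      ← ENNReal.ofReal_mul (by positivity)]
    congr 2
    have hD : (n:ℝ) + 2 = D + 1 := by rw [← hdd]; push_cast; ring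
    have hp : l ^ (-(D+s) - 1) * l ^ (n+1+1) = l ^ (-(s-1) - 1) := by
      rw [← Real.rpow_natCast l (n+1+1), ← Real.rpow_add hl0]
      congr 1
      push_cast
      linarith
    rw [hD, mul_assoc (D+s), hp]
    field_simp
  rw [setLIntegral_congr_fun measurableSet_Ioi e2, lintegral_mul_const _ (by fun_prop),
    lint_rpow _ _ (by linarith) one_pos]
  simp


def GG {d : ℕ} (u : Euc d → ℝ) (z : Euc d) : ℝ≥0∞ := ∫⁻ x, ‖u (x + z) - u x‖ₑ

lemma GG_meas {d : ℕ} {u : Euc d → ℝ} (hu : Measurable u) : Measurable (GG u) := by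
  unfold GG
  apply Measurable.lintegral_prod_right'
    (f := fun q : Euc d × Euc d => ‖u (q.2 + q.1) - u q.2‖ₑ)
  fun_prop

lemma ker_meas (d : ℕ) (s r : ℝ) : Measurable (_root_.ker d s r) := by
  unfold _root_.ker
  exact Measurable.ite measurableSet_Iic (by fun_prop) (by fun_prop)

lemma Jt_two (d : ℕ) (s r : ℝ) (E : Set (Euc d)) (hE : MeasurableSet E) :
    2 * Jt d s r E = ∫⁻ z, ENNReal.ofReal (ker d s r ‖z‖) * GG (E.indicator (1 : Euc d → ℝ)) z := by
  set u := E.indicator (1 : Euc d → ℝ) with hu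
  have hum : Measurable u := measurable_one.indicator hE
  have hk := ker_meas d s r
  set k : Euc d → Euc d → ℝ≥0∞ := fun x y => ENNReal.ofReal (ker d s r (dist x y)) with hkd
  have hkm : Measurable (fun q : Euc d × Euc d => k q.1 q.2) := by
    simp only [hkd]
    exact (hk.comp (measurable_fst.dist measurable_snd)).ennreal_ofReal
  have e1 : ∫⁻ z, ENNReal.ofReal (ker d s r ‖z‖) * GG u z
      = ∫⁻ x, ∫⁻ y, k x y * ‖u y - u x‖ₑ := by
    unfold GG
    simp_rw [← lintegral_const_mul' _ _ ENNReal.ofReal_ne_top]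
    rw [lintegral_lintegral_swap]
    · apply lintegral_congr
      intro x
      rw [← lintegral_add_left_eq_self (fun y => k x y * ‖u y - u x‖ₑ) x]
      apply lintegral_congr
      intro z
      simp [hkd, dist_eq_norm]
    · apply Measurable.aemeasurable
      refine Measurable.mul ((hk.comp measurable_fst.norm).ennreal_ofReal) ?_
      fun_prop
  have e2 : ∀ x, ∫⁻ y, k x y * ‖u y - u x‖ₑ
      = E.indicator (fun x => ∫⁻ y in Eᶜ, k x y) x + Eᶜ.indicator (fun x => ∫⁻ y in E, k x y) x := by
    intro x
    by_cases hx : x ∈ E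
    · rw [indicator_of_mem hx, indicator_of_notMem (by simpa using hx), add_zero,
        ← lintegral_indicator hE.compl]
      apply lintegral_congr
      intro y
      by_cases hy : y ∈ E <;> simp [hu, hx, hy]
    · rw [indicator_of_notMem hx, indicator_of_mem (by simpa using hx), zero_add,
        ← lintegral_indicator hE]
      apply lintegral_congr
      intro y
      by_cases hy : y ∈ E <;> simp [hu, hx, hy]
  have hm1 : Measurable (fun x => ∫⁻ y in Eᶜ, k x y) := hkm.lintegral_prod_right'
  rw [e1]
  simp_rw [e2]
  rw [lintegral_add_left (hm1.indicator hE), lintegral_indicator hE,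
    lintegral_indicator hE.compl]
  have e3 : ∫⁻ x in Eᶜ, ∫⁻ y in E, k x y = ∫⁻ x in E, ∫⁻ y in Eᶜ, k x y := by
    rw [lintegral_lintegral_swap hkm.aemeasurable]
    apply lintegral_congr; intro x
    apply lintegral_congr; intro y
    simp [hkd, dist_comm]
  rw [e3, two_mul]
  rfl

lemma ker_scale (d : ℕ) (s r t : ℝ) (hr : 0 < r) (ht : 0 ≤ t) :
    ker d s r (r * t) = r ^ (-((d:ℝ)+s)) * ker d s 1 t := by
  unfold _root_.ker
  have : r * t ≤ r ↔ t ≤ 1 := by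
    constructor <;> intro h <;> nlinarith
  by_cases h : t ≤ 1
  · simp [this, h]
  · simp only [this, h, if_false]
    rw [Real.mul_rpow hr.le ht]

lemma Jt_scale (d : ℕ) (s r : ℝ) (hr : 0 < r) (E : Set (Euc d)) (hE : MeasurableSet E) :
    2 * Jt d s r E = ENNReal.ofReal (r ^ (1 - s)) * ∫⁻ w, ENNReal.ofReal (ker d s 1 ‖w‖) *
      (GG (E.indicator (1 : Euc d → ℝ)) (r • w) / ENNReal.ofReal r) := by
  have hum : Measurable (E.indicator (1 : Euc d → ℝ)) := measurable_one.indicator hE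
  rw [Jt_two _ _ _ _ hE, lint_scale d r hr (fun z => ENNReal.ofReal (ker d s r ‖z‖) * GG (E.indicator (1 : Euc d → ℝ)) z)
    (((ker_meas d s r).comp measurable_norm).ennreal_ofReal.mul (GG_meas hum)),
    ← lintegral_const_mul' _ _ ENNReal.ofReal_ne_top,
    ← lintegral_const_mul' _ _ ENNReal.ofReal_ne_top]
  apply lintegral_congr
  intro w
  rw [norm_smul, Real.norm_of_nonneg hr.le, ker_scale _ _ _ _ hr (norm_nonneg _),
    ENNReal.ofReal_mul (by positivity), div_eq_mul_inv, ← ENNReal.ofReal_inv_of_pos hr]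
  have : r ^ (1 - s) * r⁻¹ = r ^ d * r ^ (-((d:ℝ)+s)) := by
    rw [← Real.rpow_natCast, ← Real.rpow_neg_one, ← Real.rpow_add hr, ← Real.rpow_add hr]
    congr 1; ring
  have h2 : ENNReal.ofReal (r ^ (1 - s)) * ENNReal.ofReal r⁻¹ =
     ENNReal.ofReal (r ^ d) * ENNReal.ofReal (r ^ (-((d:ℝ)+s))) := by
    rw [← ENNReal.ofReal_mul (by positivity), ← ENNReal.ofReal_mul (by positivity), this]
  generalize GG (E.indicator (1 : Euc d → ℝ)) (r • w) = X
  generalize ENNReal.ofReal (ker d s 1 ‖w‖) = Y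
  calc _ = (ENNReal.ofReal (r ^ d) * ENNReal.ofReal (r ^ (-((d:ℝ)+s)))) * (Y * X) := by ring
    _ = _ := by rw [← h2]; ring

lemma GG_le_fderiv {d : ℕ} {v : Euc d → ℝ} (hv : ContDiff ℝ 1 v) (z : Euc d) :
    GG v z ≤ ∫⁻ x, ‖fderiv ℝ v x z‖ₑ := by
  have hc : Continuous (fderiv ℝ v) := hv.continuous_fderiv (by norm_num)
  have h1 : ∀ x, ‖v (x + z) - v x‖ₑ ≤ ∫⁻ t in Ioc (0:ℝ) 1, ‖fderiv ℝ v (x + t • z) z‖ₑ := by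
    intro x
    have hd : ∀ t ∈ uIcc (0:ℝ) 1, HasDerivAt (fun t : ℝ => v (x + t • z))
        (fderiv ℝ v (x + t • z) z) t := by
      intro t _
      have h2 : HasDerivAt (fun t : ℝ => x + t • z) z t := by
        simpa using ((hasDerivAt_id t).smul_const z).const_add x
      exact ((hv.differentiable (by norm_num) _).hasFDerivAt).comp_hasDerivAt t h2
    have h3 := intervalIntegral.integral_eq_sub_of_hasDerivAt hd (by
      apply Continuous.intervalIntegrable; fun_prop)
    simp only [one_smul, zero_smul, add_zero] at h3
    rw [← h3, intervalIntegral.integral_of_le zero_le_one]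
    exact enorm_integral_le_lintegral_enorm _
  calc GG v z ≤ ∫⁻ x, ∫⁻ t in Ioc (0:ℝ) 1, ‖fderiv ℝ v (x + t • z) z‖ₑ := lintegral_mono h1
    _ = ∫⁻ t in Ioc (0:ℝ) 1, ∫⁻ x, ‖fderiv ℝ v (x + t • z) z‖ₑ := by
      apply lintegral_lintegral_swap
      apply Continuous.aemeasurable
      fun_prop
    _ = ∫⁻ t in Ioc (0:ℝ) 1, ∫⁻ x, ‖fderiv ℝ v x z‖ₑ := by
      apply lintegral_congr; intro t
      exact lintegral_add_right_eq_self (fun x => ‖fderiv ℝ v x z‖ₑ) (t • z)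
    _ = _ := by simp

lemma fderiv_le_liminf {d : ℕ} {v : Euc d → ℝ} (hv : ContDiff ℝ 1 v) (w : Euc d) :
    ∫⁻ x, ‖fderiv ℝ v x w‖ₑ ≤
      liminf (fun r : ℝ => GG v (r • w) / ENNReal.ofReal r) (nhdsWithin 0 (Ioi 0)) := by
  have hvc : Continuous v := hv.continuous
  have h1 : ∀ x, Tendsto (fun r : ℝ => ‖v (x + r • w) - v x‖ₑ / ENNReal.ofReal r)
      (nhdsWithin 0 (Ioi 0)) (nhds ‖fderiv ℝ v x w‖ₑ) := by
    intro x
    have h2 : HasDerivAt (fun t : ℝ => x + t • w) w 0 := by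
      simpa using ((hasDerivAt_id (0:ℝ)).smul_const w).const_add x
    have h3 : HasDerivAt (fun t : ℝ => v (x + t • w)) (fderiv ℝ v x w) 0 := by
      have := ((hv.differentiable (by norm_num) (x + (0:ℝ) • w)).hasFDerivAt).comp_hasDerivAt 0 h2
      rw [zero_smul, add_zero] at this
      exact this
    have h4 := h3.tendsto_slope_zero_right.enorm
    refine h4.congr' ?_
    filter_upwards [self_mem_nhdsWithin] with r hr
    have hr' : 0 < r := hr
    simp only [zero_add, zero_smul, add_zero]
    rw [enorm_smul, ENNReal.div_eq_inv_mul, ← ENNReal.ofReal_inv_of_pos hr',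
      Real.enorm_of_nonneg (by positivity)]
  calc ∫⁻ x, ‖fderiv ℝ v x w‖ₑ = ∫⁻ x, liminf (fun r : ℝ => ‖v (x + r • w) - v x‖ₑ / ENNReal.ofReal r) (nhdsWithin 0 (Ioi 0)) := by
        apply lintegral_congr; intro x; exact (h1 x).liminf_eq.symm
    _ ≤ liminf (fun r : ℝ => ∫⁻ x, ‖v (x + r • w) - v x‖ₑ / ENNReal.ofReal r) (nhdsWithin 0 (Ioi 0)) := by
        apply lintegral_liminf_le
        intro r
        apply Measurable.div_const
        apply Continuous.measurable
        fun_prop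
    _ = _ := by
        congr 1; ext r
        simp_rw [div_eq_mul_inv]
        rw [lintegral_mul_const]
        · rfl
        · apply Continuous.measurable
          fun_prop

lemma GG_young {d : ℕ} {u φ : Euc d → ℝ} (hu : Measurable u) (hub : ∀ x, |u x| ≤ 1)
    (hφ : Continuous φ) (hφc : HasCompactSupport φ) (hφ0 : ∀ x, 0 ≤ φ x) (hφ1 : ∫ x, φ x = 1)
    (z : Euc d) :
    GG (convolution φ u (ContinuousLinearMap.lsmul ℝ ℝ) volume) z ≤ GG u z := by
  have hint : Integrable φ := hφ.integrable_of_hasCompactSupport hφc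
  have hI : ∀ x, Integrable (fun t => φ t * u (x - t)) := by
    intro x
    apply hint.mul_bdd (c := 1)
    · exact (hu.comp (by fun_prop)).aestronglyMeasurable
    · exact Eventually.of_forall fun t => by simpa using hub (x - t)
  have h1 : ∀ x, ‖convolution φ u (ContinuousLinearMap.lsmul ℝ ℝ) volume (x + z)
      - convolution φ u (ContinuousLinearMap.lsmul ℝ ℝ) volume x‖ₑ
      ≤ ∫⁻ t, ‖φ t‖ₑ * ‖u (x - t + z) - u (x - t)‖ₑ := by
    intro x
    simp only [convolution_def, ContinuousLinearMap.lsmul_apply, smul_eq_mul]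
    rw [← integral_sub (hI _) (hI _)]
    refine (enorm_integral_le_lintegral_enorm _).trans (le_of_eq ?_)
    apply lintegral_congr; intro t
    rw [← mul_sub, enorm_mul, sub_add_eq_add_sub]
  have h2 : ∫⁻ t, ‖φ t‖ₑ = 1 := by
    have := ofReal_integral_eq_lintegral_ofReal hint (Eventually.of_forall hφ0)
    rw [hφ1, ENNReal.ofReal_one] at this
    rw [this]
    apply lintegral_congr; intro t
    exact Real.enorm_of_nonneg (hφ0 t)
  calc _ ≤ ∫⁻ x, ∫⁻ t, ‖φ t‖ₑ * ‖u (x - t + z) - u (x - t)‖ₑ := lintegral_mono h1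
    _ = ∫⁻ t, ∫⁻ x, ‖φ t‖ₑ * ‖u (x - t + z) - u (x - t)‖ₑ := by
      apply lintegral_lintegral_swap
      apply Measurable.aemeasurable
      have := hφ.measurable
      fun_prop
    _ = ∫⁻ t, ‖φ t‖ₑ * GG u z := by
      apply lintegral_congr; intro t
      rw [lintegral_const_mul' _ _ enorm_ne_top]
      congr 1
      exact lintegral_sub_right_eq_self (fun x => ‖u (x + z) - u x‖ₑ) t
    _ = _ := by
      rw [lintegral_mul_const _ hφ.measurable.enorm, h2, one_mul]


lemma clm_sum {d : ℕ} (D : Euc d →L[ℝ] ℝ) (ψ : Euc d) :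
    ∑ i, D (EuclideanSpace.single i 1) * ψ i = D ψ := by
  conv_rhs => rw [← (EuclideanSpace.basisFun (Fin d) ℝ).sum_repr ψ]
  simp [mul_comm]

def trc (d : ℕ) : (Euc d →L[ℝ] Euc d) →L[ℝ] ℝ :=
  ∑ i : Fin d, (EuclideanSpace.proj i : Euc d →L[ℝ] ℝ).comp
    (ContinuousLinearMap.apply ℝ (Euc d) (EuclideanSpace.single i (1:ℝ)))

lemma trc_apply {d : ℕ} (A : Euc d →L[ℝ] Euc d) :
    trc d A = ∑ i : Fin d, A (EuclideanSpace.single i 1) i := by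
  simp [trc]

lemma diverg_conv {d : ℕ} {φ : Euc d → ℝ} (hφ : ContDiff ℝ 1 φ) (hφc : HasCompactSupport φ)
    {Ψ : Euc d → Euc d} (hΨ : LocallyIntegrable Ψ) (y : Euc d) :
    diverg (convolution φ Ψ (ContinuousLinearMap.lsmul ℝ ℝ) volume) y
      = ∫ x, fderiv ℝ φ (y - x) (Ψ x) := by
  have h1 := (hφc.hasFDerivAt_convolution_left (ContinuousLinearMap.lsmul ℝ ℝ) hφ hΨ y).fderiv
  have hex := ((hφc.fderiv ℝ).convolutionExists_left
    (ContinuousLinearMap.precompL (Euc d) (ContinuousLinearMap.lsmul ℝ ℝ : ℝ →L[ℝ] Euc d →L[ℝ] Euc d))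
    (hφ.continuous_fderiv (by norm_num)) hΨ y).integrable_swap
  unfold diverg
  rw [← trc_apply, h1, convolution_eq_swap, ← ContinuousLinearMap.integral_comp_comm _ hex]
  congr 1
  ext x
  rw [trc_apply, ← clm_sum]
  simp [ContinuousLinearMap.precompL_apply]

lemma fderiv_conv {d : ℕ} {φ : Euc d → ℝ} (hφ : ContDiff ℝ 1 φ) (hφc : HasCompactSupport φ)
    {u : Euc d → ℝ} (hu : LocallyIntegrable u) (x w : Euc d) :
    fderiv ℝ (convolution φ u (ContinuousLinearMap.lsmul ℝ ℝ) volume) x w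
      = ∫ y, fderiv ℝ φ (x - y) w * u y := by
  have h1 := (hφc.hasFDerivAt_convolution_left (ContinuousLinearMap.lsmul ℝ ℝ) hφ hu x).fderiv
  have hex := ((hφc.fderiv ℝ).convolutionExists_left
    (ContinuousLinearMap.precompL (Euc d) (ContinuousLinearMap.lsmul ℝ ℝ : ℝ →L[ℝ] ℝ →L[ℝ] ℝ))
    (hφ.continuous_fderiv (by norm_num)) hu x).integrable_swap
  rw [h1, convolution_eq_swap, ContinuousLinearMap.integral_apply hex]
  simp [ContinuousLinearMap.precompL_apply]

lemma conv_bound {d : ℕ} {F : Type*} [NormedAddCommGroup F] [NormedSpace ℝ F]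
    {φ : Euc d → ℝ} (hφ : Continuous φ) (hφc : HasCompactSupport φ)
    (hφ0 : ∀ x, 0 ≤ φ x) (hφ1 : ∫ x, φ x = 1) {Ψ : Euc d → F} (hb : ∀ x, ‖Ψ x‖ ≤ 1) (x : Euc d) :
    ‖convolution φ Ψ (ContinuousLinearMap.lsmul ℝ ℝ) volume x‖ ≤ 1 := by
  rw [convolution_def, ← hφ1]
  apply norm_integral_le_of_norm_le (hφ.integrable_of_hasCompactSupport hφc)
  refine Eventually.of_forall fun t => ?_
  simp only [ContinuousLinearMap.lsmul_apply, norm_smul, Real.norm_of_nonneg (hφ0 t)]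
  exact mul_le_of_le_one_right (hφ0 t) (hb _)

lemma fderiv_odd {d : ℕ} {φ : Euc d → ℝ} (hφ : ContDiff ℝ 1 φ)
    (hs : ∀ x, φ (-x) = φ x) (x : Euc d) : fderiv ℝ φ (-x) = - fderiv ℝ φ x := by
  have h : φ = fun x => φ (-x) := by ext x; rw [hs]
  have h1 : HasFDerivAt (fun x : Euc d => φ (-x)) _ x :=
    ((hφ.differentiable (by norm_num) (-x)).hasFDerivAt).comp x (hasFDerivAt_id x).neg
  rw [← h] at h1
  rw [h1.fderiv]
  ext w
  simp

lemma per_ge {d : ℕ} {E : Set (Euc d)} (hE : MeasurableSet E) (hEfin : volume E < ⊤)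
    {φ : Euc d → ℝ} (hφ : ContDiff ℝ 1 φ) (hφc : HasCompactSupport φ) (hφs : ∀ x, φ (-x) = φ x)
    (hφ0 : ∀ x, 0 ≤ φ x) (hφ1 : ∫ x, φ x = 1) (R : ℝ) :
    ∫⁻ x in ball (0:Euc d) R, ‖fderiv ℝ (convolution φ (E.indicator (1 : Euc d → ℝ))
      (ContinuousLinearMap.lsmul ℝ ℝ) volume) x‖ₑ ≤ Per d E := by
  set u := E.indicator (1 : Euc d → ℝ) with hu
  have hui : Integrable u := (integrable_indicator_iff hE).2 (integrableOn_const hEfin.ne)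
  have hul := hui.locallyIntegrable
  set v := convolution φ u (ContinuousLinearMap.lsmul ℝ ℝ) volume with hv
  have hvC : ContDiff ℝ 1 v := hφc.contDiff_convolution_left (n := 1) _ hφ hul
  have hvc : Continuous (fderiv ℝ v) := hvC.continuous_fderiv (by norm_num)
  set f : Euc d → Euc d := fun x => (InnerProductSpace.toDual ℝ (Euc d)).symm (fderiv ℝ v x) with hf
  have hfc : Continuous f := (LinearIsometryEquiv.continuous _).comp hvc
  have hfn : ∀ x, ‖f x‖ = ‖fderiv ℝ v x‖ := fun x => by simp [hf]
  have hfv : ∀ x w, fderiv ℝ v x w = inner ℝ (f x) w := fun x w => by simp [hf]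
  set Ψ : Euc d → Euc d := (ball (0:Euc d) R).indicator (fun x => -(‖f x‖⁻¹ • f x)) with hΨ
  have hΨm : Measurable Ψ := by
    apply Measurable.indicator _ measurableSet_ball
    have := hfc.measurable
    fun_prop
  have hb : ∀ x, ‖Ψ x‖ ≤ (ball (0:Euc d) R).indicator (1 : Euc d → ℝ) x := by
    intro x
    by_cases hx : x ∈ ball (0:Euc d) R
    · rw [hΨ, indicator_of_mem hx, indicator_of_mem hx, norm_neg, norm_smul, norm_inv, norm_norm]
      exact inv_mul_le_one
    · rw [hΨ, indicator_of_notMem hx, indicator_of_notMem hx, norm_zero]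
  have hb1 : ∀ x, ‖Ψ x‖ ≤ 1 := fun x => (hb x).trans (by
    apply indicator_le' <;> simp)
  have hBi : Integrable ((ball (0:Euc d) R).indicator (1 : Euc d → ℝ)) :=
    (integrable_indicator_iff measurableSet_ball).2 (integrableOn_const measure_ball_lt_top.ne)
  have hΨi : Integrable Ψ := hBi.mono' hΨm.aestronglyMeasurable (Eventually.of_forall hb)
  have hΨc : HasCompactSupport Ψ := by
    apply HasCompactSupport.of_support_subset_isCompact (isCompact_closedBall (0:Euc d) R)
    refine (support_indicator_subset).trans ball_subset_closedBall
  set Θ := convolution φ Ψ (ContinuousLinearMap.lsmul ℝ ℝ) volume with hΘ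
  have hΘ1 : ContDiff ℝ 1 Θ := hφc.contDiff_convolution_left (n := 1) _ hφ hΨi.locallyIntegrable
  have hΘ2 : HasCompactSupport Θ := hφc.convolution _ hΨc
  have hΘ3 : ∀ x, ‖Θ x‖ ≤ 1 := conv_bound hφ.continuous hφc hφ0 hφ1 hb1
  have hper : ENNReal.ofReal (∫ x in E, diverg Θ x) ≤ Per d E := by
    unfold Per
    exact le_iSup₂_of_le Θ hΘ1 (le_iSup₂_of_le hΘ2 hΘ3 le_rfl)
  refine le_trans (le_of_eq ?_) hper
  have hDc : Continuous (fderiv ℝ φ) := hφ.continuous_fderiv (by norm_num)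
  obtain ⟨C, hC⟩ := (hφc.fderiv ℝ).exists_bound_of_continuous hDc
  have hC0 : 0 ≤ C := (norm_nonneg _).trans (hC 0)
  have hprod : Integrable (fun q : Euc d × Euc d => u q.1 * fderiv ℝ φ (q.1 - q.2) (Ψ q.2))
      (volume.prod volume) := by
    have hum : Measurable u := measurable_one.indicator hE
    refine Integrable.mono' ((hui.mul_prod hBi).const_mul C) ?_ (Eventually.of_forall ?_)
    · apply Measurable.aestronglyMeasurable
      refine (hum.comp measurable_fst).mul ?_
      have hc : Continuous (fun p : (Euc d →L[ℝ] ℝ) × Euc d => p.1 p.2) :=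
        isBoundedBilinearMap_apply.continuous
      have hD1 : Measurable (fun q : Euc d × Euc d => fderiv ℝ φ (q.1 - q.2)) :=
        (hDc.comp (by fun_prop)).measurable
      exact hc.measurable.comp (hD1.prodMk (hΨm.comp measurable_snd))
    · intro q
      rw [norm_mul]
      have h1 : ‖u q.1‖ = u q.1 := Real.norm_of_nonneg (by
        apply indicator_nonneg; simp)
      have h2 : ‖fderiv ℝ φ (q.1 - q.2) (Ψ q.2)‖ ≤ C * (ball (0:Euc d) R).indicator (1 : Euc d → ℝ) q.2 :=
        ((fderiv ℝ φ (q.1 - q.2)).le_opNorm _).trans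
          (mul_le_mul (hC _) (hb _) (norm_nonneg _) hC0)
      rw [h1]
      have h0 : 0 ≤ u q.1 := by rw [← h1]; exact norm_nonneg _
      calc _ ≤ u q.1 * (C * (ball (0:Euc d) R).indicator (1 : Euc d → ℝ) q.2) :=
            mul_le_mul_of_nonneg_left h2 h0
        _ = _ := by ring
  have e1 : ∫ y in E, diverg Θ y = ∫ y, ∫ x, u y * fderiv ℝ φ (y - x) (Ψ x) := by
    rw [← integral_indicator hE]
    congr 1; ext y
    rw [integral_const_mul, ← diverg_conv hφ hφc hΨi.locallyIntegrable]
    by_cases hy : y ∈ E <;> simp [hu, hy, hΘ]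
  have e2 : ∀ x, ∫ y, u y * fderiv ℝ φ (y - x) (Ψ x)
      = (ball (0:Euc d) R).indicator (fun x => ‖fderiv ℝ v x‖) x := by
    intro x
    have : ∀ y, u y * fderiv ℝ φ (y - x) (Ψ x) = - (fderiv ℝ φ (x - y) (Ψ x) * u y) := by
      intro y
      rw [← neg_sub x y, fderiv_odd hφ hφs]
      simp [mul_comm]
    simp_rw [this]
    rw [integral_neg, ← fderiv_conv hφ hφc hul, ← hv, hfv]
    by_cases hx : x ∈ ball (0:Euc d) R
    · rw [hΨ, indicator_of_mem hx, indicator_of_mem hx, inner_neg_right, neg_neg, inner_smul_right,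
        real_inner_self_eq_norm_sq, hfn]
      by_cases h0 : ‖fderiv ℝ v x‖ = 0
      · rw [h0]; simp
      · field_simp
    · rw [hΨ, indicator_of_notMem hx, indicator_of_notMem hx]; simp
  rw [e1, integral_integral_swap hprod]
  simp_rw [e2]
  rw [integral_indicator measurableSet_ball, ofReal_integral_norm_eq_lintegral_enorm]
  exact (hvc.locallyIntegrable.integrableOn_isCompact (isCompact_closedBall (0:Euc d) R)).mono_set
    ball_subset_closedBall

lemma per_ge' {d : ℕ} {E : Set (Euc d)} (hE : MeasurableSet E) (hEfin : volume E < ⊤)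
    {φ : Euc d → ℝ} (hφ : ContDiff ℝ 1 φ) (hφc : HasCompactSupport φ) (hφs : ∀ x, φ (-x) = φ x)
    (hφ0 : ∀ x, 0 ≤ φ x) (hφ1 : ∫ x, φ x = 1) :
    ∫⁻ x, ‖fderiv ℝ (convolution φ (E.indicator (1 : Euc d → ℝ))
      (ContinuousLinearMap.lsmul ℝ ℝ) volume) x‖ₑ ≤ Per d E := by
  rw [← setLIntegral_univ, ← iUnion_ball_nat (0 : Euc d), setLIntegral_iUnion_of_directed]
  · exact iSup_le fun n => per_ge hE hEfin hφ hφc hφs hφ0 hφ1 n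
  · apply Monotone.directed_le
    intro m n h
    apply ball_subset_ball
    exact_mod_cast h

lemma ibp {d : ℕ} {v : Euc d → ℝ} (hv : ContDiff ℝ 1 v) {Φ : Euc d → Euc d}
    (hΦ : ContDiff ℝ 1 Φ) (hΦc : HasCompactSupport Φ) :
    ∫ x, v x * diverg Φ x = - ∫ x, fderiv ℝ v x (Φ x) := by
  have hvc := hv.continuous
  have hdv : Continuous (fderiv ℝ v) := hv.continuous_fderiv (by norm_num)
  have hdΦ : Continuous (fderiv ℝ Φ) := hΦ.continuous_fderiv (by norm_num)
  have hΦcont := hΦ.continuous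
  have hcomp : ∀ i, ContDiff ℝ 1 (fun x => Φ x i) := fun i =>
    (EuclideanSpace.proj i : Euc d →L[ℝ] ℝ).contDiff.comp hΦ
  have hcs : ∀ i, HasCompactSupport (fun x => Φ x i) := fun i =>
    hΦc.comp_left (g := fun y : Euc d => y i) rfl
  have hfd : ∀ i x w, fderiv ℝ Φ x w i = fderiv ℝ (fun x => Φ x i) x w := by
    intro i x w
    have h := (EuclideanSpace.proj i : Euc d →L[ℝ] ℝ).hasFDerivAt.comp x
      (hΦ.differentiable (by norm_num) x).hasFDerivAt
    have h' : fderiv ℝ (fun x => Φ x i) x = _ := h.fderiv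
    rw [h']; rfl
  have hi2 : ∀ i, Integrable (fun x => v x * fderiv ℝ (fun x => Φ x i) x (EuclideanSpace.single i 1)) := by
    intro i
    apply Continuous.integrable_of_hasCompactSupport
    · have := (hcomp i).continuous_fderiv (by norm_num)
      fun_prop
    · exact ((hcs i).fderiv_apply (𝕜 := ℝ) _).mul_left
  have hi1 : ∀ i, Integrable (fun x => fderiv ℝ v x (EuclideanSpace.single i 1) * Φ x i) := by
    intro i
    apply Continuous.integrable_of_hasCompactSupport
    · have := (hcomp i).continuous
      fun_prop
    · exact (hcs i).mul_left
  have hi3 : ∀ i, Integrable (fun x => v x * Φ x i) := by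
    intro i
    apply Continuous.integrable_of_hasCompactSupport
    · have := (hcomp i).continuous
      fun_prop
    · exact (hcs i).mul_left
  have key : ∀ i, ∫ x, v x * fderiv ℝ (fun x => Φ x i) x (EuclideanSpace.single i 1)
      = - ∫ x, fderiv ℝ v x (EuclideanSpace.single i 1) * Φ x i := fun i =>
    integral_mul_fderiv_eq_neg_fderiv_mul_of_integrable (hi1 i) (hi2 i) (hi3 i)
      (fun x _ => hv.differentiable (by norm_num) x)
      (fun x _ => (hcomp i).differentiable (by norm_num) x)
  have e1 : ∀ x, v x * diverg Φ x
      = ∑ i, v x * fderiv ℝ (fun x => Φ x i) x (EuclideanSpace.single i 1) := by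
    intro x
    unfold diverg
    simp_rw [hfd, Finset.mul_sum]
  have e2 : ∀ x, fderiv ℝ v x (Φ x) = ∑ i, fderiv ℝ v x (EuclideanSpace.single i 1) * Φ x i :=
    fun x => (clm_sum _ _).symm
  simp_rw [e1, e2]
  rw [integral_finsetSum _ (fun i _ => hi2 i), integral_finsetSum _ (fun i _ => hi1 i)]
  simp_rw [key]
  simp

lemma per_le_iSup {d : ℕ} {E : Set (Euc d)} (hE : MeasurableSet E)
    {v : ℕ → Euc d → ℝ} (hv : ∀ n, ContDiff ℝ 1 (v n)) (hb : ∀ n x, ‖v n x‖ ≤ 1)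
    (hlim : ∀ᵐ x, Tendsto (fun n => v n x) atTop (nhds (E.indicator (1 : Euc d → ℝ) x))) :
    Per d E ≤ ⨆ n, ∫⁻ x, ‖fderiv ℝ (v n) x‖ₑ := by
  unfold Per
  refine iSup₂_le fun Φ hΦ => iSup₂_le fun hΦc hΦb => ?_
  have hdΦ : Continuous (fderiv ℝ Φ) := hΦ.continuous_fderiv (by norm_num)
  have hdc : Continuous (diverg Φ) := by
    have : diverg Φ = fun x => trc d (fderiv ℝ Φ x) := by
      ext x; rw [trc_apply]; rfl
    rw [this]; fun_prop
  have hds : HasCompactSupport (diverg Φ) := by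
    have : diverg Φ = fun x => trc d (fderiv ℝ Φ x) := by
      ext x; rw [trc_apply]; rfl
    rw [this]
    exact (hΦc.fderiv ℝ).comp_left (g := trc d) (map_zero _)
  have hdi : Integrable (diverg Φ) := hdc.integrable_of_hasCompactSupport hds
  have h1 : Tendsto (fun n => ∫ x, v n x * diverg Φ x) atTop (nhds (∫ x in E, diverg Φ x)) := by
    rw [← integral_indicator hE]
    apply tendsto_integral_of_dominated_convergence (fun x => ‖diverg Φ x‖)
    · intro n
      exact ((hv n).continuous.mul hdc).aestronglyMeasurable
    · exact hdi.norm
    · intro n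
      refine Eventually.of_forall fun x => ?_
      rw [norm_mul]
      exact mul_le_of_le_one_left (norm_nonneg _) (hb n x)
    · filter_upwards [hlim] with x hx
      have := hx.mul_const (diverg Φ x)
      convert this using 2
      by_cases h : x ∈ E <;> simp [h]
  refine le_of_tendsto (ENNReal.tendsto_ofReal h1) (Eventually.of_forall fun n => ?_)
  refine le_trans ?_ (le_iSup _ n)
  rw [ibp (hv n) hΦ hΦc]
  calc ENNReal.ofReal (- ∫ x, fderiv ℝ (v n) x (Φ x))
      ≤ ‖∫ x, fderiv ℝ (v n) x (Φ x)‖ₑ := by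
        rw [Real.enorm_eq_ofReal_abs]
        exact ENNReal.ofReal_le_ofReal (neg_le_abs _)
    _ ≤ ∫⁻ x, ‖fderiv ℝ (v n) x (Φ x)‖ₑ := enorm_integral_le_lintegral_enorm _
    _ ≤ _ := by
      apply lintegral_mono
      intro x
      show ‖fderiv ℝ (v n) x (Φ x)‖ₑ ≤ ‖fderiv ℝ (v n) x‖ₑ
      rw [enorm_le_iff_norm_le]
      exact ((fderiv ℝ (v n) x).le_opNorm _).trans
        (mul_le_of_le_one_right (norm_nonneg _) (hΦb x))


lemma H_tendsto (n : ℕ) (s : ℝ) (hs : 1 < s) (E : Set (Euc (n+1)))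
    (hE : MeasurableSet E) (hEfin : volume E < ⊤) :
    Tendsto (fun r : ℝ => ∫⁻ w, ENNReal.ofReal (ker (n+1) s 1 ‖w‖) *
      (GG (E.indicator (1 : Euc (n+1) → ℝ)) (r • w) / ENNReal.ofReal r))
      (nhdsWithin 0 (Set.Ioi 0))
      (nhds (ENNReal.ofReal (2 * omegaB n * (((n+1 : ℕ):ℝ) + s) / ((((n+1 : ℕ):ℝ) + 1) * (s-1)))
        * Per (n+1) E)) := by
  set C := ENNReal.ofReal (2 * omegaB n * (((n+1 : ℕ):ℝ) + s) / ((((n+1 : ℕ):ℝ) + 1) * (s-1)))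
  set u := E.indicator (1 : Euc (n+1) → ℝ) with hu
  set K : Euc (n+1) → ℝ≥0∞ := fun w => ENNReal.ofReal (ker (n+1) s 1 ‖w‖) with hK
  have hKm : Measurable K := ((ker_meas (n+1) s 1).comp measurable_norm).ennreal_ofReal
  have hKt : ∀ w, K w ≠ ⊤ := fun w => ENNReal.ofReal_ne_top
  have hui : Integrable u := (integrable_indicator_iff hE).2 (integrableOn_const hEfin.ne)
  have hul := hui.locallyIntegrable
  have hum : Measurable u := measurable_one.indicator hE
  have hub : ∀ x, ‖u x‖ ≤ 1 := fun x => by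
    by_cases h : x ∈ E <;> simp [hu, h]
  -- bumps
  let b : ℕ → ContDiffBump (0 : Euc (n+1)) := fun m =>
    ⟨1 / ((m:ℝ) + 1), 2 * (1 / ((m:ℝ) + 1)), by positivity, by
      have : 0 < 1 / ((m:ℝ) + 1) := by positivity
      linarith⟩
  let φ : ℕ → Euc (n+1) → ℝ := fun m => (b m).normed volume
  have hφ : ∀ m, ContDiff ℝ 1 (φ m) := fun m => (b m).contDiff_normed (n := 1)
  have hφc : ∀ m, HasCompactSupport (φ m) := fun m => (b m).hasCompactSupport_normed
  have hφs : ∀ m x, φ m (-x) = φ m x := fun m x => (b m).normed_neg x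
  have hφ0 : ∀ m x, 0 ≤ φ m x := fun m x => (b m).nonneg_normed x
  have hφ1 : ∀ m, ∫ x, φ m x = 1 := fun m => (b m).integral_normed
  set v : ℕ → Euc (n+1) → ℝ := fun m =>
    convolution (φ m) u (ContinuousLinearMap.lsmul ℝ ℝ) volume with hv
  have hvC : ∀ m, ContDiff ℝ 1 (v m) := fun m =>
    (hφc m).contDiff_convolution_left (n := 1) _ (hφ m) hul
  have hvb : ∀ m x, ‖v m x‖ ≤ 1 := fun m =>
    conv_bound (hφ m).continuous (hφc m) (hφ0 m) (hφ1 m) hub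
  have hvl : ∀ᵐ x, Tendsto (fun m => v m x) atTop (nhds (u x)) := by
    apply ContDiffBump.ae_convolution_tendsto_right_of_locallyIntegrable (K := 2) _ _ hul
    · show Tendsto (fun m : ℕ => 2 * (1 / ((m:ℝ) + 1))) atTop (nhds 0)
      simpa using (tendsto_one_div_add_atTop_nhds_zero_nat (𝕜 := ℝ)).const_mul 2
    · exact Eventually.of_forall fun m => le_rfl
  have hper : ∀ m, ∫⁻ x, ‖fderiv ℝ (v m) x‖ₑ ≤ Per (n+1) E := fun m =>
    per_ge' hE hEfin (hφ m) (hφc m) (hφs m) (hφ0 m) (hφ1 m)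
  have hper2 : Per (n+1) E ≤ ⨆ m, ∫⁻ x, ‖fderiv ℝ (v m) x‖ₑ := per_le_iSup hE hvC hvb hvl
  have hdm : ∀ m, Continuous (fun q : Euc (n+1) × Euc (n+1) => fderiv ℝ (v m) q.2 q.1) := by
    intro m
    have := (hvC m).continuous_fderiv (by norm_num)
    fun_prop
  have hIm : ∀ m, Measurable (fun w => ∫⁻ x, ‖fderiv ℝ (v m) x w‖ₑ) := fun m =>
    Measurable.lintegral_prod_right'
      (f := fun q : Euc (n+1) × Euc (n+1) => ‖fderiv ℝ (v m) q.2 q.1‖ₑ) (hdm m).measurable.enorm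
  have hKD : ∀ m, ∫⁻ w, K w * ∫⁻ x, ‖fderiv ℝ (v m) x w‖ₑ = C * ∫⁻ x, ‖fderiv ℝ (v m) x‖ₑ := by
    intro m
    simp_rw [← lintegral_const_mul' _ _ (hKt _)]
    rw [lintegral_lintegral_swap]
    · simp_rw [hK, K_const n s hs]
      rw [lintegral_const_mul' _ _ ENNReal.ofReal_ne_top]
    · exact ((hKm.comp measurable_fst).mul (hdm m).measurable.enorm).aemeasurable
  have hmr : ∀ r : ℝ, Measurable (fun w => K w * (GG u (r • w) / ENNReal.ofReal r)) := by
    intro r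
    refine hKm.mul (Measurable.div_const ?_ _)
    exact (GG_meas hum).comp (measurable_const_smul r)
  -- upper bound
  have hGl : ∀ z, GG u z ≤ liminf (fun m => GG (v m) z) atTop := by
    intro z
    have h1 : ∀ᵐ x, ‖u (x + z) - u x‖ₑ = liminf (fun m => ‖v m (x + z) - v m x‖ₑ) atTop := by
      have h2 : ∀ᵐ x, Tendsto (fun m => v m (x + z)) atTop (nhds (u (x + z))) :=
        (measurePreserving_add_right volume z).quasiMeasurePreserving.ae hvl
      filter_upwards [hvl, h2] with x hx hx2
      exact ((hx2.sub hx).enorm).liminf_eq.symm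
    unfold GG
    rw [lintegral_congr_ae h1]
    apply lintegral_liminf_le
    intro m
    have := (hvC m).continuous
    apply Continuous.measurable
    fun_prop
  have hup : ∀ r : ℝ, 0 < r →
      ∫⁻ w, K w * (GG u (r • w) / ENNReal.ofReal r) ≤ C * Per (n+1) E := by
    intro r hr
    have h1 : ∀ w, K w * (GG u (r • w) / ENNReal.ofReal r)
        ≤ liminf (fun m => K w * ∫⁻ x, ‖fderiv ℝ (v m) x w‖ₑ) atTop := by
      intro w
      have h2 : ∀ m, GG (v m) (r • w) ≤ ENNReal.ofReal r * ∫⁻ x, ‖fderiv ℝ (v m) x w‖ₑ := by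
        intro m
        refine (GG_le_fderiv (hvC m) _).trans (le_of_eq ?_)
        rw [← lintegral_const_mul' _ _ ENNReal.ofReal_ne_top]
        apply lintegral_congr; intro x
        rw [map_smul, enorm_smul, Real.enorm_of_nonneg hr.le]
      have h3 : GG u (r • w) ≤ ENNReal.ofReal r * liminf (fun m => ∫⁻ x, ‖fderiv ℝ (v m) x w‖ₑ) atTop := by
        rw [← ENNReal.liminf_const_mul_of_ne_top ENNReal.ofReal_ne_top]
        exact (hGl _).trans (liminf_le_liminf (Eventually.of_forall h2))
      rw [ENNReal.liminf_const_mul_of_ne_top (hKt w)]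
      gcongr
      exact ENNReal.div_le_of_le_mul' h3
    calc _ ≤ ∫⁻ w, liminf (fun m => K w * ∫⁻ x, ‖fderiv ℝ (v m) x w‖ₑ) atTop := lintegral_mono h1
      _ ≤ liminf (fun m => ∫⁻ w, K w * ∫⁻ x, ‖fderiv ℝ (v m) x w‖ₑ) atTop :=
        lintegral_liminf_le fun m => hKm.mul (hIm m)
      _ ≤ liminf (fun m : ℕ => C * Per (n+1) E) atTop := by
        refine liminf_le_liminf (Eventually.of_forall fun m => ?_)
        show ∫⁻ w, K w * ∫⁻ x, ‖fderiv ℝ (v m) x w‖ₑ ≤ C * Per (n+1) E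
        rw [hKD]
        gcongr
        exact hper m
      _ = _ := by simp
  -- lower bound
  have hlow : C * Per (n+1) E ≤ liminf (fun r : ℝ => ∫⁻ w, K w * (GG u (r • w) / ENNReal.ofReal r))
      (nhdsWithin 0 (Ioi 0)) := by
    calc C * Per (n+1) E ≤ C * ⨆ m, ∫⁻ x, ‖fderiv ℝ (v m) x‖ₑ := by gcongr
      _ = ⨆ m, C * ∫⁻ x, ‖fderiv ℝ (v m) x‖ₑ := ENNReal.mul_iSup _ _
      _ ≤ _ := by
        refine iSup_le fun m => ?_
        rw [← hKD]
        refine le_trans (lintegral_mono fun w => ?_) (lintegral_liminf_le hmr)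
        show K w * ∫⁻ x, ‖fderiv ℝ (v m) x w‖ₑ ≤ _
        rw [ENNReal.liminf_const_mul_of_ne_top (hKt w)]
        gcongr
        refine (fderiv_le_liminf (hvC m) w).trans (liminf_le_liminf (Eventually.of_forall fun r => ?_))
        show GG (v m) (r • w) / ENNReal.ofReal r ≤ GG u (r • w) / ENNReal.ofReal r
        gcongr
        exact GG_young hum hub (hφ m).continuous (hφc m) (hφ0 m) (hφ1 m) _
  refine tendsto_of_le_liminf_of_limsup_le hlow ?_
  refine limsup_le_of_le (by isBoundedDefault) ?_
  filter_upwards [self_mem_nhdsWithin] with r hr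
  exact hup r hr

/-- For `d ≥ 2`, `s > 1` and a measurable set `E ⊆ ℝ^d` of finite Lebesgue
measure and finite perimeter, `J̃_r^s(E)/σ^s(r) → ω_{d-1}·Per(E)` as `r → 0⁺`. -/
theorem stmt0 (d : ℕ) (hd : 2 ≤ d) (s : ℝ) (hs : 1 < s) (E : Set (Euc d))
    (hEmeas : MeasurableSet E) (hEfin : volume E < ⊤) (hPer : Per d E < ⊤) :
    Tendsto (fun r : ℝ => Jt d s r E / ENNReal.ofReal (sgm d s r))
      (nhdsWithin 0 (Set.Ioi 0))
      (nhds (ENNReal.ofReal (omegaB (d - 1)) * Per d E)) := by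
  obtain ⟨n, rfl⟩ : ∃ n, d = n + 1 := ⟨d - 1, by omega⟩
  have h := H_tendsto n s hs E hEmeas hEfin
  have hs1 : 0 < s - 1 := by linarith
  set D : ℝ := ((n+1 : ℕ):ℝ) with hD
  have hD0 : 0 ≤ D := by positivity
  have hom : 0 ≤ omegaB n := ENNReal.toReal_nonneg
  set c : ℝ := (D + 1) * (s - 1) / (2 * (D + s)) with hc
  have hc0 : 0 < c := by positivity
  have h2 := ENNReal.Tendsto.const_mul (a := ENNReal.ofReal c) h (Or.inr ENNReal.ofReal_ne_top)
  have e : ENNReal.ofReal c * (ENNReal.ofReal (2 * omegaB n * (D + s) / ((D + 1) * (s-1)))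
        * Per (n+1) E) = ENNReal.ofReal (omegaB (n + 1 - 1)) * Per (n+1) E := by
    rw [← mul_assoc, ← ENNReal.ofReal_mul hc0.le, Nat.add_sub_cancel]
    congr 2
    rw [hc]
    field_simp
  rw [e] at h2
  refine h2.congr' ?_
  filter_upwards [self_mem_nhdsWithin] with r hr
  have hr' : 0 < r := hr
  have hJ := Jt_scale (n+1) s r hr' E hEmeas
  generalize (∫⁻ w, ENNReal.ofReal (ker (n+1) s 1 ‖w‖) *
      (GG (E.indicator (1 : Euc (n+1) → ℝ)) (r • w) / ENNReal.ofReal r)) = X at *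
  have hsg : sgm (n+1) s r = r ^ (1 - s) * (2 * c)⁻¹ := by
    unfold sgm
    rw [if_neg hs.ne', ← hD, hc]
    field_simp
  have hrp : 0 < r ^ (1 - s) := by positivity
  have hJ2 : Jt (n+1) s r E = ENNReal.ofReal (r ^ (1 - s) * (1/2)) * X := by
    have h22 : ENNReal.ofReal (1/2) * 2 = 1 := by
      rw [show (2:ℝ≥0∞) = ENNReal.ofReal 2 by simp, ← ENNReal.ofReal_mul (by norm_num)]
      norm_num
    calc Jt (n+1) s r E = (ENNReal.ofReal (1/2) * 2) * Jt (n+1) s r E := by rw [h22, one_mul]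
      _ = ENNReal.ofReal (1/2) * (2 * Jt (n+1) s r E) := by ring
      _ = _ := by rw [hJ, ENNReal.ofReal_mul hrp.le]; ring
  rw [hJ2, hsg, div_eq_mul_inv, ← ENNReal.ofReal_inv_of_pos (by positivity), mul_assoc,
    mul_comm X, ← mul_assoc, ← ENNReal.ofReal_mul (by positivity)]
  congr 2
  field_simp

end
end

section
/- Let d ≥ 2 and let E ⊆ ℝ^d be a bounded open set with compact C² boundary. Then lim_{r→0⁺} J̃_r^1(E)/|log r| = ω_{d−1}·H^{d−1}(∂E), where H^{d−1} is the (d−1)-dimensional Hausdorff measure. -/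
open MeasureTheory Filter Set Metric
open scoped ENNReal NNReal symmDiff

noncomputable section

/-- A bounded open set with compact `C²` boundary, encoded via a global `C²` defining
function that is nondegenerate on the boundary. -/
structure BddC2Domain (d : ℕ) (E : Set (Euc d)) : Prop where
  isOpen : IsOpen E
  bounded : Bornology.IsBounded E
  defining : ∃ f : Euc d → ℝ, ContDiff ℝ 2 f ∧ E = {x | f x < 0} ∧
    frontier E = {x | f x = 0} ∧ ∀ x ∈ frontier E, fderiv ℝ f x ≠ 0


/-! Steiner symmetrization and the isodiametric inequality -/

def fib {k : ℕ} (i : Fin k) (A : Set (Fin k → ℝ)) (x : Fin k → ℝ) : ℝ≥0∞ :=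
  volume {t : ℝ | Function.update x i t ∈ A}

def steiner {k : ℕ} (i : Fin k) (A : Set (Fin k → ℝ)) : Set (Fin k → ℝ) :=
  {x | ENNReal.ofReal (2 * |x i|) < fib i A x}

lemma measurable_fib {k : ℕ} (i : Fin k) {A : Set (Fin k → ℝ)} (hA : MeasurableSet A) :
    Measurable (fib i A) := by
  have h : Measurable (fun p : (Fin k → ℝ) × ℝ => Function.update p.1 i p.2) := by
    rw [measurable_pi_iff]
    intro j
    by_cases hj : j = i
    · subst hj; simpa using measurable_snd
    · simp only [Function.update_of_ne hj]; fun_prop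
  exact measurable_measure_prodMk_left (h hA)

lemma measurableSet_steiner {k : ℕ} (i : Fin k) {A : Set (Fin k → ℝ)} (hA : MeasurableSet A) :
    MeasurableSet (steiner i A) := by
  apply measurableSet_lt _ (measurable_fib i hA)
  fun_prop

lemma fib_update {k : ℕ} (i : Fin k) (A : Set (Fin k → ℝ)) (x : Fin k → ℝ) (t : ℝ) :
    fib i A (Function.update x i t) = fib i A x := by
  simp [fib]

lemma vol_sym (m : ℝ≥0∞) : volume {t : ℝ | ENNReal.ofReal (2 * |t|) < m} = m := by
  by_cases hm : m = ∞
  · subst hm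
    have : {t : ℝ | ENNReal.ofReal (2 * |t|) < ∞} = univ := by
      ext t; simp only [ENNReal.ofReal_lt_top, mem_univ]; exact iff_of_true trivial trivial
    rw [this]; simp
  · lift m to ℝ≥0 using hm
    have : {t : ℝ | ENNReal.ofReal (2 * |t|) < m} = Ioo (-(m:ℝ)/2) (m/2) := by
      ext t
      simp only [mem_ofPred_eq, mem_Ioo]
      rw [ENNReal.ofReal_lt_coe_iff (by positivity)]
      constructor
      · intro h
        have := abs_lt.1 (show |t| < m/2 by linarith)
        constructor <;> linarith [this.1, this.2]
      · rintro ⟨h1, h2⟩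
        have := abs_lt.2 (show -((m:ℝ)/2) < t ∧ t < m/2 from ⟨by linarith, h2⟩)
        linarith
    rw [this, Real.volume_Ioo]
    rw [show (m:ℝ)/2 - -(m:ℝ)/2 = m by ring]
    simp

lemma volume_steiner {k : ℕ} (i : Fin k) {A : Set (Fin k → ℝ)} (hA : MeasurableSet A) :
    volume (steiner i A) = volume A := by
  rw [← lintegral_indicator_one hA, ← lintegral_indicator_one (measurableSet_steiner i hA)]
  apply lintegral_eq_of_lmarginal_eq (μ := fun _ : Fin k => (volume : Measure ℝ)) {i}
  · exact measurable_one.indicator (measurableSet_steiner i hA)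
  · exact measurable_one.indicator hA
  · ext x
    rw [lmarginal_singleton, lmarginal_singleton]
    have h1 : ∀ B : Set (Fin k → ℝ), MeasurableSet B →
        ∫⁻ t, B.indicator (1 : (Fin k → ℝ) → ℝ≥0∞) (Function.update x i t) = fib i B x := by
      intro B hB
      have : (fun t => B.indicator (1 : (Fin k → ℝ) → ℝ≥0∞) (Function.update x i t))
        = {t : ℝ | Function.update x i t ∈ B}.indicator 1 := by
        ext t; simp [indicator]
      rw [this, lintegral_indicator_one]
      · rfl
      · exact (measurable_update x) hB
    beta_reduce
    rw [h1 _ hA, h1 _ (measurableSet_steiner i hA)]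
    have : fib i (steiner i A) x = volume {t : ℝ | ENNReal.ofReal (2 * |t|) < fib i A x} := by
      unfold fib
      congr 1
      ext t
      simp only [steiner, mem_ofPred_eq, fib_update, Function.update_self]
      rfl
    rw [this, vol_sym]

lemma fib_pair {P Q : Set ℝ} {D : ℝ} (hP : P.Nonempty) (hQ : Q.Nonempty)
    (h : ∀ u ∈ P, ∀ v ∈ Q, |u - v| ≤ D) : ∃ a b : ℝ, volume P ≤ ENNReal.ofReal a ∧
      volume Q ≤ ENNReal.ofReal b ∧ 0 ≤ a ∧ 0 ≤ b ∧ a + b ≤ 2 * D := by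
  obtain ⟨u0, hu0⟩ := hP
  obtain ⟨v0, hv0⟩ := hQ
  have bP : BddAbove P := ⟨v0 + D, fun u hu => by have := (abs_le.1 (h u hu v0 hv0)).2; linarith⟩
  have bP' : BddBelow P := ⟨v0 - D, fun u hu => by have := (abs_le.1 (h u hu v0 hv0)).1; linarith⟩
  have bQ : BddAbove Q := ⟨u0 + D, fun u hu => by have := (abs_le.1 (h u0 hu0 u hu)).1; linarith⟩
  have bQ' : BddBelow Q := ⟨u0 - D, fun u hu => by have := (abs_le.1 (h u0 hu0 u hu)).2; linarith⟩
  refine ⟨sSup P - sInf P, sSup Q - sInf Q, ?_, ?_, ?_, ?_, ?_⟩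
  · rw [← Real.volume_Icc]
    exact measure_mono fun u hu => ⟨csInf_le bP' hu, le_csSup bP hu⟩
  · rw [← Real.volume_Icc]
    exact measure_mono fun u hu => ⟨csInf_le bQ' hu, le_csSup bQ hu⟩
  · linarith [csInf_le bP' hu0, le_csSup bP hu0]
  · linarith [csInf_le bQ' hv0, le_csSup bQ hv0]
  · have h1 : sSup P ≤ sInf Q + D := csSup_le ⟨u0, hu0⟩ fun u hu => by
      have : u - D ≤ sInf Q := le_csInf ⟨v0, hv0⟩ fun v hv => by
        have := (abs_le.1 (h u hu v hv)).2; linarith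
      linarith
    have h2 : sSup Q ≤ sInf P + D := csSup_le ⟨v0, hv0⟩ fun v hv => by
      have : v - D ≤ sInf P := le_csInf ⟨u0, hu0⟩ fun u hu => by
        have := (abs_le.1 (h u hu v hv)).1; linarith
      linarith
    linarith

lemma steiner_dist {k : ℕ} (i : Fin k) {A : Set (Fin k → ℝ)} {D : ℝ}
    (h : ∀ x ∈ A, ∀ y ∈ A, ∑ j, (x j - y j) ^ 2 ≤ D) :
    ∀ x ∈ steiner i A, ∀ y ∈ steiner i A, ∑ j, (x j - y j) ^ 2 ≤ D := by
  intro x hx y hy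
  have hsplit : ∀ (u v : ℝ), ∑ j, (Function.update x i u j - Function.update y i v j) ^ 2
      = (u - v) ^ 2 + ∑ j ∈ Finset.univ.erase i, (x j - y j) ^ 2 := by
    intro u v
    rw [← Finset.add_sum_erase _ _ (Finset.mem_univ i)]
    congr 1
    · simp
    · apply Finset.sum_congr rfl
      intro j hj
      have := Finset.ne_of_mem_erase hj
      simp [Function.update_of_ne this]
  set R := ∑ j ∈ Finset.univ.erase i, (x j - y j) ^ 2 with hR
  have hne : ∀ z ∈ steiner i A, {t : ℝ | Function.update z i t ∈ A}.Nonempty := by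
    intro z hz
    rw [Set.nonempty_iff_ne_empty]
    intro h0
    simp [steiner, fib, h0] at hz
  have hd : ∀ u ∈ {t : ℝ | Function.update x i t ∈ A}, ∀ v ∈ {t : ℝ | Function.update y i t ∈ A},
      |u - v| ≤ Real.sqrt (D - R) := by
    intro u hu v hv
    have := h _ hu _ hv
    rw [hsplit] at this
    apply Real.abs_le_sqrt
    linarith
  have hDR : 0 ≤ D - R := by
    obtain ⟨u, hu⟩ := hne x hx
    obtain ⟨v, hv⟩ := hne y hy
    have := h _ hu _ hv
    rw [hsplit] at this
    nlinarith [sq_nonneg (u - v)]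
  obtain ⟨a, b, ha, hb, ha0, hb0, hab⟩ := fib_pair (hne x hx) (hne y hy) hd
  have hxa : 2 * |x i| < a := by
    have := lt_of_lt_of_le hx ha
    exact (ENNReal.ofReal_lt_ofReal_iff_of_nonneg (by positivity)).1 this
  have hyb : 2 * |y i| < b := by
    have := lt_of_lt_of_le hy hb
    exact (ENNReal.ofReal_lt_ofReal_iff_of_nonneg (by positivity)).1 this
  have h1 : |x i - y i| ≤ Real.sqrt (D - R) := by
    have := abs_sub (x i) (y i)
    linarith
  have h2 := hsplit (x i) (y i)
  simp only [Function.update_eq_self] at h2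
  rw [h2]
  have h3 : (x i - y i) ^ 2 ≤ D - R := by
    rw [← sq_abs, ← Real.sq_sqrt hDR]
    exact pow_le_pow_left₀ (abs_nonneg _) h1 2
  linarith

def flipInv {k : ℕ} (j : Fin k) (A : Set (Fin k → ℝ)) : Prop :=
  ∀ x ∈ A, Function.update x j (- x j) ∈ A

lemma flip_steiner_self {k : ℕ} (i : Fin k) (A : Set (Fin k → ℝ)) : flipInv i (steiner i A) := by
  intro x hx
  simpa [steiner, fib_update] using hx

lemma flip_steiner {k : ℕ} {i j : Fin k} (hij : j ≠ i) {A : Set (Fin k → ℝ)} (h : flipInv j A) :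
    flipInv j (steiner i A) := by
  intro x hx
  have : fib i A x ≤ fib i A (Function.update x j (- x j)) := by
    apply measure_mono
    intro t ht
    have := h _ ht
    simp only [mem_ofPred_eq]
    rw [Function.update_comm hij]
    simpa [Function.update_of_ne hij] using this
  simp only [steiner, mem_ofPred_eq] at hx ⊢
  rw [Function.update_of_ne hij.symm]
  exact hx.trans_le this

lemma exists_symm {k : ℕ} {A : Set (Fin k → ℝ)} (hA : MeasurableSet A) {D : ℝ}
    (h : ∀ x ∈ A, ∀ y ∈ A, ∑ j, (x j - y j) ^ 2 ≤ D) (s : Finset (Fin k)) :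
    ∃ B : Set (Fin k → ℝ), MeasurableSet B ∧ volume B = volume A ∧
      (∀ x ∈ B, ∀ y ∈ B, ∑ j, (x j - y j) ^ 2 ≤ D) ∧ ∀ j ∈ s, flipInv j B := by
  induction s using Finset.induction_on with
  | empty => exact ⟨A, hA, rfl, h, by simp⟩
  | insert i s hi ih =>
    obtain ⟨B, hB, hv, hd, hf⟩ := ih
    refine ⟨steiner i B, measurableSet_steiner i hB, by rw [volume_steiner i hB, hv],
      steiner_dist i hd, ?_⟩
    intro j hj
    by_cases hji : j = i
    · subst hji; exact flip_steiner_self _ _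
    · exact flip_steiner hji (hf j ((Finset.mem_insert.1 hj).resolve_left hji))

lemma neg_of_flip {k : ℕ} {B : Set (Fin k → ℝ)} (h : ∀ j, flipInv j B) : ∀ x ∈ B, -x ∈ B := by
  intro x hx
  have : ∀ s : Finset (Fin k), (fun j => if j ∈ s then - x j else x j) ∈ B := by
    intro s
    induction s using Finset.induction_on with
    | empty => simpa using hx
    | insert i s hi ih =>
      convert h i _ ih using 1
      ext j
      by_cases hj : j = i
      · subst hj; simp [hi]
      · simp [hj]
  have h2 := this Finset.univ
  simp only [Finset.mem_univ, if_true] at h2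
  exact h2

lemma isodiam_pi {k : ℕ} {A : Set (Fin k → ℝ)} (hA : MeasurableSet A) {D : ℝ} (hD : 0 ≤ D)
    (h : ∀ x ∈ A, ∀ y ∈ A, ∑ j, (x j - y j) ^ 2 ≤ D ^ 2) :
    volume A ≤ volume (closedBall (0 : Euc k) (D / 2)) := by
  obtain ⟨B, hB, hv, hd, hf⟩ := exists_symm hA h Finset.univ
  rw [← hv, ← (EuclideanSpace.volume_preserving_symm_measurableEquiv_toLp (Fin k)).measure_preimage
    hB.nullMeasurableSet]
  apply measure_mono
  intro x hx
  have hneg := neg_of_flip (fun j => hf j (Finset.mem_univ j)) _ hx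
  have := hd _ hx _ hneg
  rw [mem_closedBall_zero_iff, EuclideanSpace.norm_eq]
  apply Real.sqrt_le_iff.2
  refine ⟨by positivity, ?_⟩
  have h2 : ∑ j, (2 * x j) ^ 2 ≤ D ^ 2 := by
    refine le_trans (le_of_eq ?_) this
    apply Finset.sum_congr rfl
    intro j _
    simp only [MeasurableEquiv.coe_toLp_symm, Pi.neg_apply]
    ring
  simp only [mul_pow, ← Finset.mul_sum] at h2
  simp only [Real.norm_eq_abs, sq_abs]
  nlinarith

lemma vol_closedBall {k : ℕ} (x : Euc k) {r : ℝ} (hr : 0 ≤ r) :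
    volume (closedBall x r) = ENNReal.ofReal (omegaB k) * ENNReal.ofReal r ^ k := by
  rw [Measure.addHaar_closedBall _ _ hr, omegaB, ENNReal.ofReal_toReal measure_ball_lt_top.ne]
  simp [mul_comm, ENNReal.ofReal_pow hr]

lemma omegaB_pos (k : ℕ) : 0 < omegaB k :=
  ENNReal.toReal_pos (measure_ball_pos _ _ one_pos).ne' measure_ball_lt_top.ne

lemma isodiam {k : ℕ} (A : Set (Euc k)) (hA : ediam A ≠ ∞) :
    volume A ≤ ENNReal.ofReal (omegaB k / 2 ^ k) * ediam A ^ k := by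
  have hcl : IsClosed (closure A) := isClosed_closure
  set D := (ediam A).toReal with hD
  have hD0 : 0 ≤ D := ENNReal.toReal_nonneg
  have key : volume (closure A) ≤ volume (closedBall (0 : Euc k) (D / 2)) := by
    rw [← (EuclideanSpace.volume_preserving_symm_measurableEquiv_toLp (Fin k)).symm.measure_preimage
      hcl.measurableSet.nullMeasurableSet]
    apply isodiam_pi _ hD0
    · intro x hx y hy
      have h1 : edist (WithLp.toLp 2 x : Euc k) (WithLp.toLp 2 y) ≤ ediam A := by
        rw [← ediam_closure A]
        exact edist_le_ediam_of_mem hx hy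
      rw [edist_dist, ← ENNReal.ofReal_toReal hA, ENNReal.ofReal_le_ofReal_iff hD0,
        EuclideanSpace.dist_eq] at h1
      have h2 := (Real.sqrt_le_left hD0).1 h1
      simpa [Real.dist_eq, sq_abs] using h2
    · exact ((EuclideanSpace.volume_preserving_symm_measurableEquiv_toLp (Fin k)).symm.measurable)
        hcl.measurableSet
  refine (measure_mono subset_closure).trans (key.trans (le_of_eq ?_))
  rw [vol_closedBall _ (by positivity), div_eq_mul_inv D, ENNReal.ofReal_mul hD0, mul_pow,
    hD, ENNReal.ofReal_toReal hA, div_eq_mul_inv, ENNReal.ofReal_mul (omegaB_pos k).le,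
    ← inv_pow, ENNReal.ofReal_pow (by positivity)]
  ring

lemma ediam_cb_le {k : ℕ} {x : Euc k} {r : ℝ} (hr : 0 ≤ r) :
    ediam (closedBall x r) ≤ 2 * ENNReal.ofReal r := by
  rw [← closedEBall_ofReal hr]
  exact ediam_closedEBall_le

lemma vol_le_Hstd (k : ℕ) : (volume : Measure (Euc k)) ≤ Hstd k k := by
  set c := ENNReal.ofReal (omegaB k / 2 ^ k) with hc
  have hc0 : c ≠ 0 := by
    have := omegaB_pos k
    simp [hc]; positivity
  have hct : c ≠ ∞ := ENNReal.ofReal_ne_top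
  have h : c⁻¹ • (volume : Measure (Euc k)) ≤ μH[(k:ℝ)] := by
    apply Measure.le_hausdorffMeasure _ _ 1 one_pos
    intro s hs
    have := isodiam s (ne_top_of_le_ne_top ENNReal.one_ne_top hs)
    rw [Measure.smul_apply, smul_eq_mul, ENNReal.rpow_natCast]
    rw [ENNReal.inv_mul_le_iff hc0 hct]
    exact this
  intro s
  have := h s
  rw [Measure.smul_apply, smul_eq_mul, ENNReal.inv_mul_le_iff hc0 hct] at this
  simpa [Hstd] using this

lemma Hstd_le_vol (k : ℕ) (s : Set (Euc k)) : Hstd k k s ≤ volume s := by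
  set c := ENNReal.ofReal (omegaB k / 2 ^ k) with hc
  have hc0 : c ≠ 0 := by
    have := omegaB_pos k
    simp [hc]; positivity
  have hct : c ≠ ∞ := ENNReal.ofReal_ne_top
  have hcov : ∀ n : ℕ, ∃ (t : Set (Euc k)) (r : Euc k → ℝ), t.Countable ∧ t ⊆ s ∧
      (∀ x ∈ t, r x ∈ Ioo (0:ℝ) (1 / (n + 1))) ∧
      (s ⊆ ⋃ x ∈ t, closedBall x (r x)) ∧
      (∑' x : t, volume (closedBall (x : Euc k) (r x))) ≤ volume s + ((n : ℝ≥0∞) + 1)⁻¹ := by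
    intro n
    apply Besicovitch.exists_closedBall_covering_tsum_measure_le volume _ (fun _ => Ioo (0:ℝ) (1 / (n + 1)))
    · intro x hx δ hδ
      refine ⟨min δ (1 / (n+1)) / 2, ?_⟩
      have h1 : 0 < min δ (1 / ((n:ℝ)+1)) := lt_min hδ (by positivity)
      have h2 := min_le_left δ (1 / ((n:ℝ)+1))
      have h3 := min_le_right δ (1 / ((n:ℝ)+1))
      refine ⟨⟨by linarith, by linarith⟩, by linarith, by linarith⟩
    · simp
  choose t r htc hts hr hst hsum using hcov
  have hcount : ∀ n, Countable (t n) := fun n => (htc n).to_subtype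
  have hle := Measure.hausdorffMeasure_le_liminf_tsum (k : ℝ) s (l := atTop)
    (fun n : ℕ => ENNReal.ofReal (2 * (1 / ((n:ℝ) + 1))))
    (by
      have : Tendsto (fun n : ℕ => 2 * (1 / ((n:ℝ) + 1))) atTop (nhds (2 * 0)) :=
        tendsto_one_div_add_atTop_nhds_zero_nat.const_mul 2
      rw [mul_zero] at this
      simpa using ENNReal.tendsto_ofReal this)
    (fun n (x : t n) => closedBall (x : Euc k) (r n x))
    (Eventually.of_forall fun n x => by
      have h := hr n x x.2
      have := ediam_cb_le (x := (x : Euc k)) h.1.le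
      refine this.trans ?_
      rw [ENNReal.ofReal_mul (by norm_num)]
      gcongr
      · simp
      · exact h.2.le)
    (Eventually.of_forall fun n => by
      rw [← biUnion_eq_iUnion (s := t n) (t := fun x _ => closedBall x (r n x))]
      exact hst n)
  have hb : ∀ n, ∑' x : t n, ediam (closedBall (x : Euc k) (r n x)) ^ (k:ℝ) ≤
      c⁻¹ * (volume s + ((n : ℝ≥0∞) + 1)⁻¹) := by
    intro n
    refine le_trans ?_ (mul_le_mul_right (hsum n) _)
    rw [← ENNReal.tsum_mul_left]
    apply ENNReal.tsum_le_tsum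
    intro x
    have h := hr n x x.2
    have h2 := ediam_cb_le (x := (x : Euc k)) h.1.le
    rw [ENNReal.rpow_natCast, ← ENNReal.mul_le_iff_le_inv hc0 hct, vol_closedBall _ h.1.le]
    calc c * ediam (closedBall (x : Euc k) (r n x)) ^ k ≤ c * (2 * ENNReal.ofReal (r n x)) ^ k := by
          gcongr
      _ = _ := by
          rw [mul_pow, ← mul_assoc]
          congr 1
          rw [hc, show (2:ℝ≥0∞) ^ k = ENNReal.ofReal (2 ^ k) by
            rw [ENNReal.ofReal_pow (by norm_num)]; simp, ← ENNReal.ofReal_mul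
            (by have := omegaB_pos k; positivity)]
          congr 1
          field_simp
  have hlim : Tendsto (fun n : ℕ => c⁻¹ * (volume s + ((n : ℝ≥0∞) + 1)⁻¹)) atTop
      (nhds (c⁻¹ * (volume s + 0))) := by
    apply ENNReal.Tendsto.const_mul _ (Or.inr (by simp [hc0]))
    apply Tendsto.const_add
    have := ENNReal.tendsto_inv_nat_nhds_zero.comp (tendsto_add_atTop_nat 1)
    refine this.congr fun n => by simp
  have hfin : μH[(k:ℝ)] s ≤ c⁻¹ * volume s := by
    refine hle.trans ?_
    rw [add_zero] at hlim
    rw [← hlim.liminf_eq]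
    exact liminf_le_liminf (Eventually.of_forall hb)
  rw [← ENNReal.mul_le_iff_le_inv hc0 hct] at hfin
  simpa [Hstd] using hfin

lemma Hstd_self (k : ℕ) : Hstd k k = (volume : Measure (Euc k)) :=
  le_antisymm (Measure.le_iff.2 fun s _ => Hstd_le_vol k s) (vol_le_Hstd k)


/-! Layer cake and averaging -/

def AA (d : ℕ) (E : Set (Euc d)) (χ : Euc d → ℝ≥0∞) (ρ : ℝ) : ℝ≥0∞ :=
  ∫⁻ x in E, χ x * volume (Eᶜ ∩ closedBall x ρ)

lemma lintegral_Ioi_rpow {a c : ℝ} (ha : a < -1) (hc : 0 < c) :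
    ∫⁻ ρ in Ioi c, ENNReal.ofReal (ρ ^ a) = ENNReal.ofReal (-c ^ (a + 1) / (a + 1)) := by
  rw [← integral_Ioi_rpow_of_lt ha hc, ofReal_integral_eq_lintegral_ofReal
    (integrableOn_Ioi_rpow_of_lt ha hc)]
  filter_upwards [ae_restrict_mem measurableSet_Ioi] with x hx
  exact Real.rpow_nonneg (hc.le.trans (le_of_lt hx)) _

lemma ker_layer (d : ℕ) {r t : ℝ} (hr : 0 < r) :
    ENNReal.ofReal (_root_.ker d 1 r t) = ∫⁻ ρ in Ioi r, ENNReal.ofReal (((d:ℝ)+1) * ρ ^ (-((d:ℝ)+2))) *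
      (Ici t).indicator 1 ρ := by
  have h1 : ∀ c : ℝ, 0 < c → ∫⁻ ρ in Ioi c, ENNReal.ofReal (((d:ℝ)+1) * ρ ^ (-((d:ℝ)+2)))
      = ENNReal.ofReal (c ^ (-((d:ℝ)+1))) := by
    intro c hc
    simp_rw [ENNReal.ofReal_mul (show (0:ℝ) ≤ (d:ℝ)+1 by positivity)]
    rw [lintegral_const_mul _ (by fun_prop), lintegral_Ioi_rpow _ hc,
      ← ENNReal.ofReal_mul (by positivity)]
    · congr 1
      rw [show -((d:ℝ)+2)+1 = -((d:ℝ)+1) by ring]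
      field_simp
    · have : (0:ℝ) ≤ d := by positivity
      linarith
  have h2 : ∫⁻ ρ in Ioi r, ENNReal.ofReal (((d:ℝ)+1) * ρ ^ (-((d:ℝ)+2))) *
      (Ici t).indicator 1 ρ = ∫⁻ ρ in Ioi (max r t), ENNReal.ofReal (((d:ℝ)+1) * ρ ^ (-((d:ℝ)+2))) := by
    have : ∀ ρ, ENNReal.ofReal (((d:ℝ)+1) * ρ ^ (-((d:ℝ)+2))) * (Ici t).indicator 1 ρ
       = (Ici t).indicator (fun ρ => ENNReal.ofReal (((d:ℝ)+1) * ρ ^ (-((d:ℝ)+2)))) ρ := by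
      intro ρ
      by_cases h : ρ ∈ Ici t <;> simp [h]
    simp_rw [this]
    rw [lintegral_indicator measurableSet_Ici, Measure.restrict_restrict measurableSet_Ici]
    apply setLIntegral_congr
    rw [max_comm, ← Ioi_inter_Ioi]
    exact Ioi_ae_eq_Ici.symm.inter (ae_eq_refl _)
  rw [h2, h1 _ (lt_of_lt_of_le hr (le_max_left _ _)), _root_.ker]
  split_ifs with h
  · rw [max_eq_left h]
  · rw [max_eq_right (not_le.1 h).le]

lemma Jt_layer (d : ℕ) {r : ℝ} (hr : 0 < r) {E : Set (Euc d)} (hE : MeasurableSet E) :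
    Jt d 1 r E = ∫⁻ ρ in Ioi r, ENNReal.ofReal (((d:ℝ)+1) * ρ ^ (-((d:ℝ)+2))) * AA d E 1 ρ := by
  unfold Jt AA
  simp_rw [ker_layer d hr]
  have hset : MeasurableSet {p : (Euc d × Euc d) × ℝ | dist p.1.1 p.1.2 ≤ p.2} :=
    measurableSet_le (by fun_prop) (by fun_prop)
  have hm : Measurable (fun p : (Euc d × Euc d) × ℝ =>
      (Ici (dist p.1.1 p.1.2)).indicator (1 : ℝ → ℝ≥0∞) p.2) := by
    have : (fun p : (Euc d × Euc d) × ℝ =>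
      (Ici (dist p.1.1 p.1.2)).indicator (1 : ℝ → ℝ≥0∞) p.2) =
      {p : (Euc d × Euc d) × ℝ | dist p.1.1 p.1.2 ≤ p.2}.indicator 1 := by
      ext p; simp [indicator]
    rw [this]
    exact measurable_one.indicator hset
  have hm2 : Measurable (fun p : (Euc d × Euc d) × ℝ =>
      ENNReal.ofReal (((d:ℝ)+1) * p.2 ^ (-((d:ℝ)+2))) *
      (Ici (dist p.1.1 p.1.2)).indicator (1 : ℝ → ℝ≥0∞) p.2) := by
    apply Measurable.mul _ hm
    fun_prop
  have step1 : ∀ x : Euc d, ∫⁻ y in Eᶜ, ∫⁻ ρ in Ioi r,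
      ENNReal.ofReal (((d:ℝ)+1) * ρ ^ (-((d:ℝ)+2))) * (Ici (dist x y)).indicator 1 ρ
      = ∫⁻ ρ in Ioi r, ENNReal.ofReal (((d:ℝ)+1) * ρ ^ (-((d:ℝ)+2))) *
        volume (Eᶜ ∩ closedBall x ρ) := by
    intro x
    rw [lintegral_lintegral_swap]
    · congr 1
      ext ρ
      rw [lintegral_const_mul]
      · congr 1
        have : (fun y => (Ici (dist x y)).indicator (1 : ℝ → ℝ≥0∞) ρ)
            = (closedBall x ρ).indicator 1 := by
          ext y; simp [indicator, dist_comm]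
        rw [this, lintegral_indicator_one measurableSet_closedBall,
          Measure.restrict_apply measurableSet_closedBall, inter_comm]
      · exact hm.comp (f := fun y : Euc d => ((x, y), ρ)) (by fun_prop)
    · exact (hm2.comp (f := fun q : Euc d × ℝ => ((x, q.1), q.2)) (by fun_prop)).aemeasurable
  simp_rw [step1]
  have hm3 : Measurable (fun q : Euc d × ℝ => volume (Eᶜ ∩ closedBall q.1 q.2)) := by
    have h4 : MeasurableSet {p : (Euc d × ℝ) × Euc d | p.2 ∈ Eᶜ ∧ dist p.2 p.1.1 ≤ p.1.2} := by
      apply MeasurableSet.inter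
      · exact measurable_snd hE.compl
      · exact measurableSet_le (f := fun p : (Euc d × ℝ) × Euc d => dist p.2 p.1.1)
          (g := fun p : (Euc d × ℝ) × Euc d => p.1.2) (by fun_prop) (by fun_prop)
    exact measurable_measure_prodMk_left h4
  rw [lintegral_lintegral_swap]
  · congr 1
    ext ρ
    rw [lintegral_const_mul]
    · simp
    · exact hm3.comp (f := fun x : Euc d => (x, ρ)) (by fun_prop)
  · apply Measurable.aemeasurable
    apply Measurable.mul _ hm3
    fun_prop

lemma lint_inv {r δ : ℝ} (hr : 0 < r) (h : r ≤ δ) :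
    ∫⁻ ρ in Ioc r δ, ENNReal.ofReal ρ⁻¹ = ENNReal.ofReal (Real.log δ - Real.log r) := by
  have h0 : (0:ℝ) ∉ uIcc r δ := by
    rw [uIcc_of_le h]; intro h; linarith [h.1]
  rw [← Real.log_div (by linarith) hr.ne', ← integral_inv h0, intervalIntegral.integral_of_le h,
    ofReal_integral_eq_lintegral_ofReal]
  · have := intervalIntegral.intervalIntegrable_inv (f := fun x : ℝ => x) (μ := volume)
      (a := r) (b := δ) (fun x hx => fun h' => h0 (h' ▸ hx)) continuousOn_id
    exact (intervalIntegrable_iff_integrableOn_Ioc_of_le h).1 this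
  · filter_upwards [ae_restrict_mem measurableSet_Ioc] with x hx
    exact inv_nonneg.2 (hr.le.trans hx.1.le)

lemma avg (Z : ℝ → ℝ≥0∞) {C : ℝ≥0∞} (hC : C ≠ ∞) {l : ℝ≥0∞}
    (hZ : ∀ ρ > 0, Z ρ ≤ C * ENNReal.ofReal ρ⁻¹)
    (hlim : Tendsto Z (nhdsWithin 0 (Ioi 0)) (nhds l)) :
    Tendsto (fun r => (∫⁻ ρ in Ioi r, Z ρ * ENNReal.ofReal ρ⁻¹) / ENNReal.ofReal |Real.log r|)
      (nhdsWithin 0 (Ioi 0)) (nhds l) := by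
  have hlog : Tendsto (fun r : ℝ => |Real.log r|) (nhdsWithin 0 (Ioi 0)) atTop :=
    tendsto_abs_atBot_atTop.comp Real.tendsto_log_nhdsGT_zero
  have hlog' : Tendsto (fun r : ℝ => ENNReal.ofReal |Real.log r|) (nhdsWithin 0 (Ioi 0)) (nhds ∞) :=
    ENNReal.tendsto_ofReal_atTop.comp hlog
  have hM : ∀ δ : ℝ, 0 < δ → ∫⁻ ρ in Ioi δ, Z ρ * ENNReal.ofReal ρ⁻¹ ≠ ∞ := by
    intro δ hδ
    have : ∫⁻ ρ in Ioi δ, Z ρ * ENNReal.ofReal ρ⁻¹ ≤ ∫⁻ ρ in Ioi δ, C * ENNReal.ofReal (ρ ^ (-2:ℝ)) := by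
      apply setLIntegral_mono' measurableSet_Ioi
      intro ρ hρ
      have h0 : 0 < ρ := hδ.trans hρ
      calc Z ρ * ENNReal.ofReal ρ⁻¹ ≤ C * ENNReal.ofReal ρ⁻¹ * ENNReal.ofReal ρ⁻¹ := by
            gcongr; exact hZ ρ h0
        _ = _ := by
            rw [mul_assoc, ← ENNReal.ofReal_mul (by positivity)]
            congr 2
            rw [Real.rpow_neg h0.le, Real.rpow_two]
            field_simp
    refine ne_top_of_le_ne_top ?_ this
    rw [lintegral_const_mul _ (by fun_prop), lintegral_Ioi_rpow (by norm_num) hδ]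
    exact ENNReal.mul_ne_top hC ENNReal.ofReal_ne_top
  have hnear : ∀ (P : ℝ≥0∞ → Prop), (∀ᶠ ρ in nhdsWithin 0 (Ioi 0), P (Z ρ)) →
      ∃ δ : ℝ, 0 < δ ∧ δ < 1 ∧ ∀ ρ ∈ Ioc 0 δ, P (Z ρ) := by
    intro P hP
    obtain ⟨δ, hδ, h⟩ := mem_nhdsGT_iff_exists_Ioc_subset.1 hP
    refine ⟨min δ (1/2), lt_min hδ (by norm_num), (min_le_right _ _).trans_lt (by norm_num), ?_⟩
    intro ρ hρ
    exact h ⟨hρ.1, hρ.2.trans (min_le_left _ _)⟩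
  rw [tendsto_order]
  constructor
  · intro b hb
    obtain ⟨a, hba, hal⟩ := exists_between hb
    obtain ⟨δ, hδ, hδ1, hZa⟩ := hnear (fun z => a < z) ((tendsto_order.1 hlim).1 a hal)
    have hT : Tendsto (fun r : ℝ => a * ENNReal.ofReal ((Real.log δ - Real.log r) / |Real.log r|))
        (nhdsWithin 0 (Ioi 0)) (nhds (a * 1)) := by
      apply ENNReal.Tendsto.const_mul _ (Or.inr (ne_top_of_lt hal))
      rw [← ENNReal.ofReal_one]
      apply ENNReal.tendsto_ofReal
      have h1 : Tendsto (fun r : ℝ => Real.log δ / |Real.log r| + 1) (nhdsWithin 0 (Ioi 0))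
          (nhds (0 + 1)) := (hlog.const_div_atTop _).add_const 1
      rw [zero_add] at h1
      refine h1.congr' ?_
      filter_upwards [Ioo_mem_nhdsGT (show (0:ℝ) < 1 by norm_num)] with r hr
      have := Real.log_neg hr.1 hr.2
      rw [abs_of_neg this]
      have hne := this.ne
      rw [sub_div, div_neg, div_neg, div_self hne]
      ring
    rw [mul_one] at hT
    filter_upwards [(tendsto_order.1 hT).1 b hba, Ioo_mem_nhdsGT hδ] with r hr1 hr
    refine hr1.trans_le ?_
    have hl := Real.log_neg hr.1 (hr.2.trans hδ1)
    rw [ENNReal.ofReal_div_of_pos (abs_pos.2 hl.ne), ← mul_div_assoc]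
    gcongr
    rw [← lint_inv hr.1 hr.2.le]
    calc a * ∫⁻ ρ in Ioc r δ, ENNReal.ofReal ρ⁻¹ = ∫⁻ ρ in Ioc r δ, a * ENNReal.ofReal ρ⁻¹ := by
          rw [lintegral_const_mul _ (by fun_prop)]
      _ ≤ ∫⁻ ρ in Ioc r δ, Z ρ * ENNReal.ofReal ρ⁻¹ := by
          apply setLIntegral_mono' measurableSet_Ioc
          intro ρ hρ
          gcongr
          exact (hZa ρ ⟨hr.1.trans hρ.1, hρ.2⟩).le
      _ ≤ _ := lintegral_mono_set Ioc_subset_Ioi_self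
  · intro b hb
    obtain ⟨a, hla, hab⟩ := exists_between hb
    obtain ⟨δ, hδ, hδ1, hZa⟩ := hnear (fun z => z < a) ((tendsto_order.1 hlim).2 a hla)
    set M := ∫⁻ ρ in Ioi δ, Z ρ * ENNReal.ofReal ρ⁻¹ with hMd
    have hT : Tendsto (fun r : ℝ => a + M / ENNReal.ofReal |Real.log r|)
        (nhdsWithin 0 (Ioi 0)) (nhds (a + 0)) := by
      apply Tendsto.const_add
      have := ENNReal.Tendsto.const_div (a := M) hlog' (Or.inr (hM δ hδ))
      simpa using this
    rw [add_zero] at hT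
    filter_upwards [(tendsto_order.1 hT).2 b hab, Ioo_mem_nhdsGT hδ] with r hr1 hr
    refine lt_of_le_of_lt ?_ hr1
    have hl := Real.log_neg hr.1 (hr.2.trans hδ1)
    have hne : ENNReal.ofReal |Real.log r| ≠ 0 := by
      simpa using ⟨hr.1.ne', by linarith [hr.1, hr.2], by linarith [hr.1, hr.2]⟩
    rw [show a + M / ENNReal.ofReal |Real.log r| =
      (a * ENNReal.ofReal |Real.log r| + M) / ENNReal.ofReal |Real.log r| by
        rw [ENNReal.add_div, ENNReal.mul_div_cancel_right hne ENNReal.ofReal_ne_top]]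
    gcongr
    rw [← Ioc_union_Ioi_eq_Ioi hr.2.le]
    refine (lintegral_union_le _ _ _).trans ?_
    gcongr
    calc ∫⁻ ρ in Ioc r δ, Z ρ * ENNReal.ofReal ρ⁻¹ ≤ ∫⁻ ρ in Ioc r δ, a * ENNReal.ofReal ρ⁻¹ := by
          apply setLIntegral_mono' measurableSet_Ioc
          intro ρ hρ
          gcongr
          exact (hZa ρ ⟨hr.1.trans hρ.1, hρ.2⟩).le
      _ = a * ENNReal.ofReal (Real.log δ - Real.log r) := by
          rw [lintegral_const_mul _ (by fun_prop), lint_inv hr.1 hr.2.le]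
      _ ≤ _ := by
          gcongr
          rw [abs_of_neg hl]
          have := Real.log_neg hδ hδ1
          linarith

lemma Jt_lim (d : ℕ) {E : Set (Euc d)} (hE : MeasurableSet E) (hEv : volume E ≠ ∞) {l : ℝ≥0∞}
    (hlim : Tendsto (fun ρ => AA d E 1 ρ / ENNReal.ofReal ρ ^ (d + 1)) (nhdsWithin 0 (Ioi 0)) (nhds l)) :
    Tendsto (fun r : ℝ => Jt d 1 r E / ENNReal.ofReal (sgm d 1 r))
      (nhdsWithin 0 (Set.Ioi 0)) (nhds (ENNReal.ofReal ((d:ℝ)+1) * l)) := by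
  have hb : ∀ ρ > 0, AA d E 1 ρ / ENNReal.ofReal ρ ^ (d + 1) ≤
      (volume E * ENNReal.ofReal (omegaB d)) * ENNReal.ofReal ρ⁻¹ := by
    intro ρ hρ
    have h0 : ENNReal.ofReal ρ ≠ 0 := by simpa using hρ
    have h1 : AA d E 1 ρ ≤ volume E * (ENNReal.ofReal (omegaB d) * ENNReal.ofReal ρ ^ d) := by
      unfold AA
      calc _ ≤ ∫⁻ x in E, (ENNReal.ofReal (omegaB d) * ENNReal.ofReal ρ ^ d) := by
            apply lintegral_mono
            intro x
            simp only [Pi.one_apply, one_mul]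
            rw [← vol_closedBall x hρ.le]
            exact measure_mono inter_subset_right
        _ = _ := by simp [mul_comm]
    rw [ENNReal.ofReal_inv_of_pos hρ]
    apply ENNReal.div_le_of_le_mul
    refine h1.trans (le_of_eq ?_)
    rw [pow_succ]
    rw [show volume E * ENNReal.ofReal (omegaB d) * (ENNReal.ofReal ρ)⁻¹ *
      (ENNReal.ofReal ρ ^ d * ENNReal.ofReal ρ) = volume E * ENNReal.ofReal (omegaB d) *
      ENNReal.ofReal ρ ^ d * ((ENNReal.ofReal ρ)⁻¹ * ENNReal.ofReal ρ) by ring,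
      ENNReal.inv_mul_cancel h0 ENNReal.ofReal_ne_top]
    ring
  have := avg _ (ENNReal.mul_ne_top hEv ENNReal.ofReal_ne_top) hb hlim
  have h2 := ENNReal.Tendsto.const_mul (a := ENNReal.ofReal ((d:ℝ)+1)) this
    (Or.inr ENNReal.ofReal_ne_top)
  refine h2.congr' ?_
  filter_upwards [self_mem_nhdsWithin] with r hr
  have hr : 0 < r := hr
  rw [Jt_layer d hr hE, sgm, if_pos rfl, ← mul_div_assoc]
  congr 1
  rw [← lintegral_const_mul' _ _ ENNReal.ofReal_ne_top]
  apply setLIntegral_congr_fun measurableSet_Ioi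
  intro ρ hρ
  have hρ : 0 < ρ := hr.trans hρ
  have h0 : ENNReal.ofReal ρ ≠ 0 := by simpa using hρ
  simp only
  rw [ENNReal.ofReal_mul (by positivity), mul_assoc]
  congr 1
  rw [div_eq_mul_inv, mul_assoc, mul_comm]
  congr 1
  rw [← ENNReal.ofReal_pow hρ.le, ← ENNReal.ofReal_inv_of_pos (by positivity),
    ← ENNReal.ofReal_mul (by positivity)]
  congr 1
  rw [Real.rpow_neg hρ.le, show ((d:ℝ)+2) = ((d+2 : ℕ):ℝ) by push_cast; ring, Real.rpow_natCast]
  field_simp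
  ring


/-! The flat model -/

def emb {k : ℕ} (t : ℝ) (w : Euc k) : Euc (k+1) := WithLp.toLp 2 (Fin.cons t w.ofLp)

lemma emb_zero {k : ℕ} (t : ℝ) (w : Euc k) : emb t w 0 = t := rfl

lemma emb_succ {k : ℕ} (t : ℝ) (w : Euc k) (j : Fin k) : emb t w j.succ = w j := rfl

lemma norm_emb_sq {k : ℕ} (t : ℝ) (w : Euc k) : ‖emb t w‖ ^ 2 = t ^ 2 + ‖w‖ ^ 2 := by
  rw [EuclideanSpace.norm_sq_eq, EuclideanSpace.norm_sq_eq, Fin.sum_univ_succ]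
  simp [emb_zero, emb_succ]

lemma emb_sub {k : ℕ} (t t' : ℝ) (w w' : Euc k) : emb t w - emb t' w' = emb (t - t') (w - w') := by
  ext j
  refine Fin.cases ?_ (fun j => ?_) j <;> rfl

lemma isometry_emb {k : ℕ} (t : ℝ) : Isometry (emb t : Euc k → Euc (k+1)) := by
  apply Isometry.of_dist_eq
  intro x y
  rw [dist_eq_norm, dist_eq_norm, emb_sub]
  have := norm_emb_sq (t - t) (x - y)
  simp only [sub_self, ne_eq, OfNat.ofNat_ne_zero, not_false_eq_true, zero_pow, zero_add] at this
  rw [sub_self]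
  exact (sq_eq_sq₀ (norm_nonneg _) (norm_nonneg _)).1 this

lemma continuous_emb {k : ℕ} : Continuous (fun p : ℝ × Euc k => emb p.1 p.2) := by
  unfold emb
  apply (PiLp.continuous_toLp 2 _).comp
  rw [continuous_pi_iff]
  intro j
  refine Fin.cases ?_ (fun j => ?_) j
  · exact continuous_fst
  · simp only [Fin.cons_succ]; fun_prop

lemma range_emb {k : ℕ} (t : ℝ) : range (emb t : Euc k → Euc (k+1)) = {z | z 0 = t} := by
  ext z
  constructor
  · rintro ⟨w, rfl⟩; rfl
  · intro hz
    refine ⟨WithLp.toLp 2 (fun j => z j.succ), ?_⟩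
    ext j
    refine Fin.cases ?_ (fun j => ?_) j
    · exact hz.symm
    · rfl

lemma mp_emb {k : ℕ} : MeasurePreserving (fun p : ℝ × Euc k => emb p.1 p.2)
    ((volume : Measure ℝ).prod (volume : Measure (Euc k))) volume := by
  have h1 := (MeasurePreserving.id (volume : Measure ℝ)).prod (PiLp.volume_preserving_ofLp (Fin k))
  have h2 := (volume_preserving_piFinSuccAbove (fun _ : Fin (k+1) => ℝ) 0).symm
  have h3 := PiLp.volume_preserving_toLp (Fin (k+1))
  have := h3.comp (h2.comp h1)
  have he : (fun p : ℝ × Euc k => emb p.1 p.2) = WithLp.toLp 2 ∘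
      (MeasurableEquiv.piFinSuccAbove (fun _ : Fin (k+1) => ℝ) 0).symm ∘ Prod.map id WithLp.ofLp := by
    funext p
    refine congrArg (WithLp.toLp 2) ?_
    funext j
    refine Fin.cases ?_ (fun j => ?_) j
    · simp [MeasurableEquiv.piFinSuccAbove]
    · simp [MeasurableEquiv.piFinSuccAbove]
  rw [he]
  exact this

lemma lintegral_emb {k : ℕ} {F : Euc (k+1) → ℝ≥0∞} (hF : Measurable F) :
    ∫⁻ z, F z = ∫⁻ t : ℝ, ∫⁻ w : Euc k, F (emb t w) := by
  rw [← mp_emb.lintegral_comp hF, lintegral_prod]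
  exact (hF.comp continuous_emb.measurable).aemeasurable

lemma Hstd_restrict_plane {k : ℕ} :
    (Hstd (k+1) k).restrict {z | z 0 = 0} = Measure.map (emb 0) (volume : Measure (Euc k)) := by
  rw [← Hstd_self, Hstd, Hstd, Measure.map_smul, (isometry_emb 0).map_hausdorffMeasure
    (Or.inl (by positivity)), range_emb, Measure.restrict_smul]

def Vcap (k : ℕ) (s : ℝ) : ℝ≥0∞ := volume {z : Euc (k+1) | s ≤ z 0 ∧ ‖z‖ ≤ 1}

def Hm (k : ℕ) : Set (Euc (k+1)) := {z | z 0 < 0}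

open scoped Pointwise in
lemma vol_flat {k : ℕ} (x : Euc (k+1)) {ρ : ℝ} (hρ : 0 < ρ) :
    volume ((Hm k)ᶜ ∩ closedBall x ρ) = ENNReal.ofReal ρ ^ (k+1) * Vcap k (- x 0 / ρ) := by
  have h1 : (fun y => x + y) ⁻¹' ((Hm k)ᶜ ∩ closedBall x ρ) =
      ρ • {z : Euc (k+1) | - x 0 / ρ ≤ z 0 ∧ ‖z‖ ≤ 1} := by
    ext y
    rw [mem_smul_set_iff_inv_smul_mem₀ hρ.ne']
    simp only [Hm, mem_preimage, mem_inter_iff, mem_compl_iff, mem_ofPred_eq, mem_closedBall,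
      not_lt, PiLp.add_apply, dist_self_add_left, PiLp.smul_apply, smul_eq_mul, norm_smul, norm_inv,
      Real.norm_eq_abs, abs_of_pos hρ]
    rw [inv_mul_le_iff₀ hρ, div_le_iff₀ hρ, mul_one, mul_comm (ρ⁻¹), mul_assoc,
      inv_mul_cancel₀ hρ.ne', mul_one]
    constructor <;> rintro ⟨h1, h2⟩ <;> exact ⟨by linarith, h2⟩
  rw [← measure_preimage_add volume x, h1, Measure.addHaar_smul, Vcap]
  congr 1
  simp [abs_of_pos hρ, ENNReal.ofReal_pow hρ.le]

lemma measurable_Vcap (k : ℕ) : Measurable (Vcap k) := by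
  have h : MeasurableSet {p : ℝ × Euc (k+1) | p.1 ≤ p.2 0 ∧ ‖p.2‖ ≤ 1} := by
    apply MeasurableSet.inter
    · exact measurableSet_le (f := fun p : ℝ × Euc (k+1) => p.1)
        (g := fun p : ℝ × Euc (k+1) => p.2 0) (by fun_prop) (by fun_prop)
    · exact measurableSet_le (f := fun p : ℝ × Euc (k+1) => ‖p.2‖)
        (g := fun p : ℝ × Euc (k+1) => (1:ℝ)) (by fun_prop) (by fun_prop)
  exact measurable_measure_prodMk_left h

lemma real_int (k : ℕ) : ∫ u in (0:ℝ)..1, u * Real.sqrt (1 - u^2) ^ k = 1 / ((k:ℝ) + 2) := by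
  have hd : ∀ u ∈ uIcc (0:ℝ) 1, HasDerivAt (fun u : ℝ => - (1 - u^2) ^ (((k:ℝ)+2)/2) / ((k:ℝ)+2))
      (u * Real.sqrt (1 - u^2) ^ k) u := by
    intro u hu
    rw [uIcc_of_le zero_le_one] at hu
    have hnn : 0 ≤ 1 - u^2 := by nlinarith [hu.1, hu.2]
    have h1 : HasDerivAt (fun u : ℝ => 1 - u^2) (-(2*u)) u := by
      simpa using ((hasDerivAt_id u).pow 2).const_sub 1
    have hk : (0:ℝ) ≤ k := by positivity
    have h2 := ((h1.rpow_const (p := ((k:ℝ)+2)/2) (Or.inr (by linarith))).neg).div_const ((k:ℝ)+2)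
    refine HasDerivAt.congr_deriv (f := fun u : ℝ => - (1 - u^2) ^ (((k:ℝ)+2)/2) / ((k:ℝ)+2)) h2 ?_
    rw [Real.sqrt_eq_rpow, ← Real.rpow_mul_natCast hnn, show ((k:ℝ)+2)/2 - 1 = 1/2 * k by ring]
    field_simp
  rw [intervalIntegral.integral_eq_sub_of_hasDerivAt hd]
  · have : ((k:ℝ)+2)/2 ≠ 0 := by positivity
    simp [Real.zero_rpow this]
    ring
  · apply Continuous.intervalIntegrable
    fun_prop

lemma slice_vol (k : ℕ) (u : ℝ) (hu : 0 ≤ u) : volume {w : Euc k | ‖emb u w‖ ≤ 1} =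
    if u ≤ 1 then ENNReal.ofReal (omegaB k) * ENNReal.ofReal (Real.sqrt (1 - u^2)) ^ k else 0 := by
  have hiff : ∀ w : Euc k, ‖emb u w‖ ≤ 1 ↔ u^2 + ‖w‖^2 ≤ 1 := by
    intro w
    rw [← norm_emb_sq]
    constructor
    · intro h; exact pow_le_one₀ (norm_nonneg _) h
    · intro h; exact (sq_le_one_iff₀ (norm_nonneg _)).1 h
  simp_rw [hiff]
  split_ifs with h
  · rw [← vol_closedBall (0 : Euc k) (Real.sqrt_nonneg _)]
    congr 1
    ext w
    simp only [mem_ofPred_eq, mem_closedBall_zero_iff]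
    rw [Real.le_sqrt (norm_nonneg _) (by nlinarith)]
    constructor <;> intro h <;> linarith
  · convert measure_empty (μ := (volume : Measure (Euc k)))
    ext w
    simp only [mem_ofPred_eq, mem_empty_iff_false, iff_false, not_le]
    nlinarith [sq_nonneg ‖w‖]

lemma int_Vcap (k : ℕ) : ∫⁻ s in Ioi 0, Vcap k s = ENNReal.ofReal (omegaB k / ((k:ℝ) + 2)) := by
  have hV : ∀ s, 0 < s → Vcap k s = ∫⁻ u, (Ici s).indicator 1 u * volume {w : Euc k | ‖emb u w‖ ≤ 1} := by
    intro s hs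
    have hms : MeasurableSet {z : Euc (k+1) | s ≤ z 0 ∧ ‖z‖ ≤ 1} := by
      apply MeasurableSet.inter
      · exact measurableSet_le (f := fun p : Euc (k+1) => s)
          (g := fun p : Euc (k+1) => p 0) (by fun_prop) (by fun_prop)
      · exact measurableSet_le (f := fun p : Euc (k+1) => ‖p‖)
          (g := fun p : Euc (k+1) => (1:ℝ)) (by fun_prop) (by fun_prop)
    rw [Vcap, ← lintegral_indicator_one hms, lintegral_emb (measurable_one.indicator hms)]
    congr 1
    ext u
    by_cases hu : s ≤ u
    · have hmw : MeasurableSet {w : Euc k | ‖emb u w‖ ≤ 1} :=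
        measurableSet_le (f := fun w : Euc k => ‖emb u w‖) (g := fun _ => (1:ℝ))
          (isometry_emb u).continuous.norm.measurable (by fun_prop)
      rw [← lintegral_indicator_one hmw]
      simp [indicator, emb_zero, hu]
    · simp [indicator, emb_zero, hu]
  rw [setLIntegral_congr_fun measurableSet_Ioi (fun s hs => hV s hs)]
  have hms : MeasurableSet {p : ℝ × Euc k | ‖emb p.1 p.2‖ ≤ 1} :=
    measurableSet_le (f := fun p : ℝ × Euc k => ‖emb p.1 p.2‖) (g := fun _ => (1:ℝ))
          continuous_emb.norm.measurable (by fun_prop)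
  have hmb : Measurable (fun u => volume {w : Euc k | ‖emb u w‖ ≤ 1}) :=
    measurable_measure_prodMk_left hms
  have hind : ∀ s u : ℝ, (Ici s).indicator (1 : ℝ → ℝ≥0∞) u = (Iic u).indicator 1 s := by
    intro s u; simp [indicator]
  rw [lintegral_lintegral_swap]
  · have h1 : ∀ u, ∫⁻ s in Ioi (0:ℝ), (Ici s).indicator 1 u * volume {w : Euc k | ‖emb u w‖ ≤ 1} =
        ENNReal.ofReal u * volume {w : Euc k | ‖emb u w‖ ≤ 1} := by
      intro u
      simp_rw [hind]
      rw [lintegral_mul_const _ (measurable_one.indicator measurableSet_Iic),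
        lintegral_indicator_one measurableSet_Iic, Measure.restrict_apply measurableSet_Iic,
        inter_comm, Ioi_inter_Iic, Real.volume_Ioc, sub_zero]
    simp_rw [h1]
    have h2 : ∀ u, ENNReal.ofReal u * volume {w : Euc k | ‖emb u w‖ ≤ 1} =
        (Ioc (0:ℝ) 1).indicator (fun u => ENNReal.ofReal (omegaB k) *
          ENNReal.ofReal (u * Real.sqrt (1 - u^2) ^ k)) u := by
      intro u
      by_cases h0 : 0 < u
      · rw [slice_vol k u h0.le]
        by_cases hu1 : u ≤ 1
        · rw [indicator_of_mem (show u ∈ Ioc (0:ℝ) 1 from ⟨h0, hu1⟩), if_pos hu1,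
            ENNReal.ofReal_mul h0.le, ENNReal.ofReal_pow (Real.sqrt_nonneg _)]
          ring
        · rw [indicator_of_notMem (fun h => hu1 h.2), if_neg hu1, mul_zero]
      · rw [indicator_of_notMem (fun h => h0 h.1), ENNReal.ofReal_of_nonpos (not_lt.1 h0), zero_mul]
    simp_rw [h2]
    rw [lintegral_indicator measurableSet_Ioc, lintegral_const_mul _ (by fun_prop),
      ← ofReal_integral_eq_lintegral_ofReal, ← intervalIntegral.integral_of_le zero_le_one,
      real_int, ← ENNReal.ofReal_mul (omegaB_pos k).le]
    · congr 1; ring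
    · have : Continuous (fun u : ℝ => u * Real.sqrt (1 - u^2) ^ k) := by fun_prop
      exact (this.integrableOn_Icc (a := 0) (b := 1)).mono_set Ioc_subset_Icc_self
    · filter_upwards [ae_restrict_mem measurableSet_Ioc] with x hx
      have := hx.1.le
      positivity
  · apply Measurable.aemeasurable
    apply Measurable.mul _ (hmb.comp measurable_snd)
    have : (fun p : ℝ × ℝ => (Ici p.1).indicator (1 : ℝ → ℝ≥0∞) p.2) =
        {p : ℝ × ℝ | p.1 ≤ p.2}.indicator 1 := by
      ext p; simp [indicator]
    have h3 : Measurable (fun p : ℝ × ℝ => (Ici p.1).indicator (1 : ℝ → ℝ≥0∞) p.2) := by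
      rw [this]
      exact measurable_one.indicator (measurableSet_le measurable_fst measurable_snd)
    exact h3

lemma cont_slice {k : ℕ} {ψ : Euc (k+1) → ℝ≥0∞} (hc : Continuous ψ) (h1 : ∀ x, ψ x ≤ 1)
    {R : ℝ} (hR : ∀ x, ψ x ≠ 0 → ‖x‖ ≤ R) :
    Continuous (fun t => ∫⁻ w : Euc k, ψ (emb t w)) ∧
      ∃ M : ℝ≥0∞, M ≠ ∞ ∧ ∀ t, ∫⁻ w : Euc k, ψ (emb t w) ≤ M := by
  have hb : ∀ t (w : Euc k), ψ (emb t w) ≤ (closedBall (0 : Euc k) R).indicator 1 w := by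
    intro t w
    by_cases h : ψ (emb t w) = 0
    · rw [h]; exact zero_le
    · have h2 := hR _ h
      have h3 := norm_emb_sq t w
      have : w ∈ closedBall (0 : Euc k) R := by
        rw [mem_closedBall_zero_iff]
        refine le_trans ?_ h2
        apply le_of_sq_le_sq _ (norm_nonneg _)
        nlinarith [sq_nonneg t]
      rw [indicator_of_mem this]
      exact h1 _
  have hfin : ∫⁻ w : Euc k, (closedBall (0 : Euc k) R).indicator 1 w ≠ ∞ := by
    rw [lintegral_indicator_one measurableSet_closedBall]
    exact measure_closedBall_lt_top.ne
  refine ⟨?_, _, hfin, fun t => lintegral_mono (hb t)⟩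
  rw [continuous_iff_continuousAt]
  intro t
  apply tendsto_lintegral_filter_of_dominated_convergence _ _ _ hfin
  · apply Eventually.of_forall
    intro w
    exact ((hc.comp continuous_emb).comp (Continuous.prodMk_left w)).tendsto t
  · apply Eventually.of_forall
    intro t
    exact (hc.comp (isometry_emb t).continuous).measurable
  · exact Eventually.of_forall fun t => Eventually.of_forall (hb t)

lemma lint_subst {ρ : ℝ} (hρ : 0 < ρ) {F : ℝ → ℝ≥0∞} (hF : Measurable F) :
    ∫⁻ t, F t = ENNReal.ofReal ρ * ∫⁻ s, F (-(ρ * s)) := by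
  have h := Measure.map_addHaar_smul (volume : Measure ℝ) (r := -ρ) (by linarith)
  have h2 : ∫⁻ s, F (-(ρ * s)) = ∫⁻ t, F t ∂(Measure.map (fun s => (-ρ) • s) volume) := by
    rw [lintegral_map hF (by fun_prop)]
    simp
  have h3 : Measure.map (fun s : ℝ => (-ρ) • s) volume = ENNReal.ofReal ρ⁻¹ • (volume : Measure ℝ) := by
    rw [h]
    congr 1
    simp [abs_of_pos hρ]
  rw [h2, h3, lintegral_smul_measure, smul_eq_mul, ← mul_assoc, ← ENNReal.ofReal_mul hρ.le,
    mul_inv_cancel₀ hρ.ne']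
  simp

theorem flat_lim {k : ℕ} {ψ : Euc (k+1) → ℝ≥0∞} (hc : Continuous ψ) (h1 : ∀ x, ψ x ≤ 1)
    {R : ℝ} (hR : ∀ x, ψ x ≠ 0 → ‖x‖ ≤ R) :
    Tendsto (fun ρ => AA (k+1) (Hm k) ψ ρ / ENNReal.ofReal ρ ^ (k+1+1)) (nhdsWithin 0 (Ioi 0))
      (nhds (ENNReal.ofReal (omegaB k / ((k:ℝ) + 2)) *
        ∫⁻ z in {z | z 0 = 0}, ψ z ∂(Hstd (k+1) k))) := by
  obtain ⟨hm, M, hM, hmM⟩ := cont_slice hc h1 hR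
  set m := fun t => ∫⁻ w : Euc k, ψ (emb t w) with hmd
  have hmH : MeasurableSet (Hm k) :=
    measurableSet_lt (f := fun z : Euc (k+1) => z 0) (g := fun _ => (0:ℝ)) (by fun_prop) (by fun_prop)
  have hA : ∀ ρ, 0 < ρ → AA (k+1) (Hm k) ψ ρ / ENNReal.ofReal ρ ^ (k+1+1)
      = ∫⁻ s in Ioi 0, Vcap k s * m (-(ρ * s)) := by
    intro ρ hρ
    have h0 : ENNReal.ofReal ρ ≠ 0 := by simpa using hρ
    have hme : Measurable fun x : Euc (k+1) => ψ x * (ENNReal.ofReal ρ ^ (k+1) * Vcap k (- x 0 / ρ)) := by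
      apply hc.measurable.mul
      apply Measurable.const_mul
      apply (measurable_Vcap k).comp
      fun_prop
    have hmF : Measurable fun t : ℝ => (Iio (0:ℝ)).indicator (fun t =>
        ENNReal.ofReal ρ ^ (k+1) * (Vcap k (-t / ρ) * m t)) t := by
      apply Measurable.indicator _ measurableSet_Iio
      apply Measurable.const_mul
      apply Measurable.mul _ hm.measurable
      apply (measurable_Vcap k).comp
      fun_prop
    have e1 : AA (k+1) (Hm k) ψ ρ = ENNReal.ofReal ρ * ∫⁻ s, (Ioi (0:ℝ)).indicator (fun s =>
        ENNReal.ofReal ρ ^ (k+1) * (Vcap k s * m (-(ρ * s)))) s := by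
      unfold AA
      simp_rw [vol_flat _ hρ]
      rw [← lintegral_indicator hmH, lintegral_emb (hme.indicator hmH)]
      have : ∀ t, ∫⁻ w : Euc k, (Hm k).indicator (fun x : Euc (k+1) => ψ x *
          (ENNReal.ofReal ρ ^ (k+1) * Vcap k (- x 0 / ρ))) (emb t w) =
          (Iio (0:ℝ)).indicator (fun t => ENNReal.ofReal ρ ^ (k+1) * (Vcap k (-t / ρ) * m t)) t := by
        intro t
        by_cases ht : t < 0
        · have : ∀ w : Euc k, emb t w ∈ Hm k := fun w => ht
          rw [indicator_of_mem (show t ∈ Iio (0:ℝ) from ht)]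
          simp_rw [indicator_of_mem (this _), emb_zero]
          rw [lintegral_mul_const _ (show Measurable fun w : Euc k => ψ (emb t w) from
            (hc.comp (isometry_emb t).continuous).measurable)]
          ring
        · have : ∀ w : Euc k, emb t w ∉ Hm k := fun w => ht
          rw [indicator_of_notMem (show t ∉ Iio (0:ℝ) from ht)]
          simp_rw [indicator_of_notMem (this _)]
          simp
      simp_rw [this]
      rw [lint_subst hρ hmF]
      congr 2
      ext s
      by_cases hs : 0 < s
      · rw [indicator_of_mem (show s ∈ Ioi (0:ℝ) from hs), indicator_of_mem]
        · congr 3; field_simp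
        · simp only [mem_Iio, Left.neg_neg_iff]; positivity
      · rw [indicator_of_notMem (show s ∉ Ioi (0:ℝ) from hs), indicator_of_notMem]
        simp only [mem_Iio, Left.neg_neg_iff, not_lt]
        exact mul_nonpos_of_nonneg_of_nonpos hρ.le (not_lt.1 hs)
    rw [e1, lintegral_indicator measurableSet_Ioi, lintegral_const_mul' _ _
      (ENNReal.pow_ne_top ENNReal.ofReal_ne_top), ← mul_assoc, ← pow_succ', mul_comm,
      ENNReal.mul_div_cancel_right (pow_ne_zero _ h0) (ENNReal.pow_ne_top ENNReal.ofReal_ne_top)]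
  have hlim : Tendsto (fun ρ => ∫⁻ s in Ioi 0, Vcap k s * m (-(ρ * s))) (nhdsWithin 0 (Ioi 0))
      (nhds (∫⁻ s in Ioi 0, Vcap k s * m 0)) := by
    apply tendsto_lintegral_filter_of_dominated_convergence (fun s => Vcap k s * M)
    · apply Eventually.of_forall
      intro ρ
      exact (measurable_Vcap k).mul (hm.measurable.comp (by fun_prop))
    · apply Eventually.of_forall
      intro ρ
      apply Eventually.of_forall
      intro s
      gcongr
      exact hmM _
    · rw [lintegral_mul_const _ (measurable_Vcap k), int_Vcap]
      exact ENNReal.mul_ne_top ENNReal.ofReal_ne_top hM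
    · apply Eventually.of_forall
      intro s
      have hVt : Vcap k s ≠ ∞ := by
        apply ne_top_of_le_ne_top (measure_closedBall_lt_top (μ := (volume : Measure (Euc (k+1)))) (x := (0 : Euc (k+1))) (r := 1)).ne
        apply measure_mono
        intro z hz
        simpa using hz.2
      apply ENNReal.Tendsto.const_mul _ (Or.inr hVt)
      have : Tendsto (fun ρ : ℝ => m (-(ρ * s))) (nhds 0) (nhds (m (-(0 * s)))) :=
        (hm.comp (by fun_prop : Continuous fun ρ : ℝ => -(ρ * s))).tendsto 0
      simp only [zero_mul, neg_zero] at this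
      exact this.mono_left nhdsWithin_le_nhds
  rw [lintegral_mul_const _ (measurable_Vcap k), int_Vcap] at hlim
  rw [Hstd_restrict_plane, lintegral_map hc.measurable (isometry_emb 0).continuous.measurable]
  refine hlim.congr' ?_
  filter_upwards [self_mem_nhdsWithin] with ρ hρ
  exact (hA ρ hρ).symm


/-! Transfer under bi-Lipschitz maps -/

def BiL {d : ℕ} (L : ℝ≥0) (B : Set (Euc d)) (Φ : Euc d → Euc d) : Prop :=
  ∀ x ∈ B, ∀ y ∈ B, dist (Φ x) (Φ y) ≤ L * dist x y ∧ dist x y ≤ L * dist (Φ x) (Φ y)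

lemma BiL.lip {d : ℕ} {L : ℝ≥0} {B : Set (Euc d)} {Φ : Euc d → Euc d} (h : BiL L B Φ) :
    LipschitzOnWith L Φ B := LipschitzOnWith.of_dist_le_mul fun x hx y hy => (h x hx y hy).1

lemma BiL.hstd_le {d : ℕ} {L : ℝ≥0} {B : Set (Euc d)} {Φ : Euc d → Euc d} (h : BiL L B Φ)
    (k : ℕ) {T : Set (Euc d)} (hT : T ⊆ B) :
    Hstd d k T ≤ (L : ℝ≥0∞) ^ k * Hstd d k (Φ '' T) := by
  have hinj : InjOn Φ B := by
    intro x hx y hy hxy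
    have := (h x hx y hy).2
    rw [hxy, dist_self, mul_zero] at this
    exact dist_le_zero.1 this
  have hinv : LipschitzOnWith L (Function.invFunOn Φ B) (Φ '' T) := by
    apply LipschitzOnWith.of_dist_le_mul
    rintro _ ⟨x, hx, rfl⟩ _ ⟨y, hy, rfl⟩
    rw [hinj.leftInvOn_invFunOn (hT hx), hinj.leftInvOn_invFunOn (hT hy)]
    exact (h x (hT hx) y (hT hy)).2
  have h1 := hinv.hausdorffMeasure_image_le (d := (k:ℝ)) (by positivity)
  rw [(hinj.leftInvOn_invFunOn.mono hT).image_image] at h1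
  simp only [Hstd, Measure.smul_apply, smul_eq_mul]
  rw [mul_left_comm]
  gcongr
  simpa using h1

lemma BiL.lint_le {d : ℕ} {L : ℝ≥0} {B : Set (Euc d)} {Φ : Euc d → Euc d} (h : BiL L B Φ)
    (k : ℕ) {S T : Set (Euc d)} (hS : S ⊆ B) (hSm : MeasurableSet S) (hST : ∀ x ∈ S, Φ x ∈ T)
    {g : Euc d → ℝ≥0∞} (hg : Measurable g) :
    ∫⁻ x in S, g (Φ x) ∂(Hstd d k) ≤ (L : ℝ≥0∞) ^ k * ∫⁻ y in T, g y ∂(Hstd d k) := by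
  have hae : AEMeasurable Φ ((Hstd d k).restrict S) :=
    (h.lip.continuousOn.mono hS).aemeasurable hSm
  rw [← lintegral_map' hg.aemeasurable hae, ← smul_eq_mul, ← lintegral_smul_measure]
  apply lintegral_mono' _ le_rfl
  apply Measure.le_iff.2
  intro A hA
  rw [Measure.map_apply_of_aemeasurable hae hA, Measure.restrict_apply' hSm, Measure.smul_apply,
    smul_eq_mul, Measure.restrict_apply hA]
  refine (h.hstd_le k (inter_subset_right.trans hS)).trans ?_
  gcongr
  rintro _ ⟨x, ⟨hx, hxS⟩, rfl⟩
  exact ⟨hx, hST x hxS⟩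

lemma measurable_AAint {d : ℕ} {E : Set (Euc d)} (hE : MeasurableSet E) (ρ : ℝ) :
    Measurable fun x => volume (Eᶜ ∩ closedBall x ρ) := by
  have : MeasurableSet {p : Euc d × Euc d | p.2 ∈ Eᶜ ∧ dist p.2 p.1 ≤ ρ} := by
    apply MeasurableSet.inter
    · exact hE.compl.preimage measurable_snd
    · exact measurableSet_le (f := fun p : Euc d × Euc d => dist p.2 p.1) (g := fun _ => ρ)
        (by fun_prop) (by fun_prop)
  exact measurable_measure_prodMk_left this

theorem BiL.AA_le {d : ℕ} {L : ℝ≥0} {B : Set (Euc d)} {Φ : Euc d → Euc d} (h : BiL L B Φ)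
    (hB : MeasurableSet B)
    {E1 E2 : Set (Euc d)} (hE1 : MeasurableSet E1) (hE2 : MeasurableSet E2)
    (hE : ∀ x ∈ B, (x ∈ E1 ↔ Φ x ∈ E2)) {χ ψ : Euc d → ℝ≥0∞} (hψ : Measurable ψ)
    (hχ : ∀ x ∈ B, χ x = ψ (Φ x)) {ρ : ℝ} (hρ : 0 ≤ ρ)
    (hs : ∀ x, χ x ≠ 0 → closedBall x ρ ⊆ B) :
    AA d E1 χ ρ ≤ (L : ℝ≥0∞) ^ (2 * d) * AA d E2 ψ (L * ρ) := by
  have h1 : ∀ x ∈ E1, χ x * volume (E1ᶜ ∩ closedBall x ρ) ≤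
      (L : ℝ≥0∞) ^ d * (E1 ∩ B).indicator (fun x => ψ (Φ x) * volume (E2ᶜ ∩ closedBall (Φ x) (L * ρ))) x := by
    intro x hx
    by_cases h0 : χ x = 0
    · simp [h0]
    have hb := hs x h0
    have hxB : x ∈ B := hb (mem_closedBall_self hρ)
    rw [indicator_of_mem (show x ∈ E1 ∩ B from ⟨hx, hxB⟩), hχ x hxB, mul_left_comm]
    gcongr
    rw [← Hstd_self d]
    refine (h.hstd_le d (inter_subset_right.trans hb)).trans ?_
    gcongr
    rintro _ ⟨y, ⟨hy, hyb⟩, rfl⟩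
    have hyB := hb hyb
    refine ⟨fun hc => hy ((hE y hyB).2 hc), ?_⟩
    rw [mem_closedBall] at hyb ⊢
    exact (h y hyB x hxB).1.trans (by gcongr)
  calc AA d E1 χ ρ ≤ ∫⁻ x in E1, (L : ℝ≥0∞) ^ d * (E1 ∩ B).indicator
        (fun x => ψ (Φ x) * volume (E2ᶜ ∩ closedBall (Φ x) (L * ρ))) x :=
        setLIntegral_mono' hE1 h1
    _ = (L : ℝ≥0∞) ^ d * ∫⁻ x in E1 ∩ B,
        (fun y => ψ y * volume (E2ᶜ ∩ closedBall y (L * ρ))) (Φ x) := by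
        rw [lintegral_const_mul' _ _ (ENNReal.pow_ne_top ENNReal.coe_ne_top),
          lintegral_indicator (hE1.inter hB), Measure.restrict_restrict (hE1.inter hB)]
        congr 3
        ext x; simp only [mem_inter_iff]; tauto
    _ ≤ (L : ℝ≥0∞) ^ d * ((L : ℝ≥0∞) ^ d * AA d E2 ψ (L * ρ)) := by
        gcongr
        have := h.lint_le d (S := E1 ∩ B) (T := E2) inter_subset_right (hE1.inter hB)
          (fun x hx => (hE x hx.2).1 hx.1)
          (g := fun y => ψ y * volume (E2ᶜ ∩ closedBall y (L * ρ)))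
          (hψ.mul (measurable_AAint hE2 _))
        rw [Hstd_self] at this
        exact this
    _ = _ := by rw [← mul_assoc, ← pow_add, two_mul]


/-! Local charts -/

lemma exists_chart {k : ℕ} {f : Euc (k+1) → ℝ} (hf : ContDiff ℝ 2 f) {p : Euc (k+1)}
    (hd : fderiv ℝ f p ≠ 0) {L : ℝ≥0} (hL : 1 < L) :
    ∃ (e : OpenPartialHomeomorph (Euc (k+1)) (Euc (k+1))) (c : ℝ), 0 < c ∧ p ∈ e.source ∧
      BiL L e.source e ∧ ∀ x, e x 0 = c * f x := by
  obtain ⟨v, hv⟩ : ∃ v : Euc (k+1), ∀ y, fderiv ℝ f p y = inner ℝ v y :=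
    ⟨(InnerProductSpace.toDual ℝ _).symm (fderiv ℝ f p), fun y => by simp⟩
  have hv0 : v ≠ 0 := by
    rintro rfl
    apply hd
    ext y
    simp [hv]
  have hvn : 0 < ‖v‖ := norm_pos_iff.2 hv0
  set n : Euc (k+1) := ‖v‖⁻¹ • v with hn
  have hnn : ‖n‖ = 1 := by rw [hn, norm_smul, norm_inv, norm_norm, inv_mul_cancel₀ hvn.ne']
  have hon : Orthonormal ℝ (({0} : Set (Fin (k+1))).domRestrict (fun _ => n)) := by
    constructor
    · intro i; exact hnn
    · intro i j hij
      exact absurd (Subsingleton.elim i j) hij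
  obtain ⟨b, hb⟩ := hon.exists_orthonormalBasis_extension_of_card_eq (by simp)
  have hb0 : b 0 = n := hb 0 rfl
  have hrep : ∀ y, b.repr y 0 = inner ℝ n y := by
    intro y; rw [b.repr_apply_apply, hb0]
  set Φ : Euc (k+1) → Euc (k+1) := fun x =>
    b.repr ((x - p) + (‖v‖⁻¹ * f x - inner ℝ n (x - p)) • n) with hΦ
  have hΦ0 : ∀ x, Φ x 0 = ‖v‖⁻¹ * f x := by
    intro x
    rw [hΦ]
    simp only [hrep]
    rw [inner_add_right, inner_smul_right, real_inner_self_eq_norm_sq, hnn]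
    ring
  set R : Euc (k+1) ≃L[ℝ] Euc (k+1) := b.repr.toContinuousLinearEquiv with hR
  have hder : HasStrictFDerivAt Φ (R : Euc (k+1) →L[ℝ] Euc (k+1)) p := by
    have h1 : HasStrictFDerivAt f (fderiv ℝ f p) p :=
      hf.contDiffAt.hasStrictFDerivAt (by norm_num)
    have h2 : HasStrictFDerivAt (fun x : Euc (k+1) => x - p) (ContinuousLinearMap.id ℝ _) p :=
      (hasStrictFDerivAt_id p).sub_const p
    have h3 : HasStrictFDerivAt (fun x : Euc (k+1) => (inner ℝ n (x - p) : ℝ)) (innerSL ℝ n) p :=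
      HasStrictFDerivAt.comp (g := fun z : Euc (k+1) => (inner ℝ n z : ℝ)) (g' := innerSL ℝ n)
        (f := fun x : Euc (k+1) => x - p) p ((innerSL ℝ n).hasStrictFDerivAt) h2
    have h4 := h2.add (((h1.const_mul ‖v‖⁻¹).sub h3).smul_const n)
    have h5 := ((R : Euc (k+1) →L[ℝ] Euc (k+1)).hasStrictFDerivAt).comp p h4
    refine HasStrictFDerivAt.congr_fderiv h5 ?_
    ext1 y
    have : ‖v‖⁻¹ * (inner ℝ v y : ℝ) - inner ℝ n y = 0 := by
      rw [hn, real_inner_smul_left, sub_self]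
    simp [hv, this]
  have hRn : ∀ y, ‖R y‖ = ‖y‖ := fun y => b.repr.norm_map y
  set N := ‖(R.symm : Euc (k+1) →L[ℝ] Euc (k+1))‖₊ with hN
  have hN0 : 0 < N⁻¹ := by
    rw [inv_pos]
    exact R.nnnorm_symm_pos
  set c : ℝ≥0 := min ((L - 1) / L) (N⁻¹ / 2) with hc
  have hL0 : 0 < L := zero_lt_one.trans hL
  have hc0 : 0 < c := by
    rw [hc, lt_min_iff]
    exact ⟨div_pos (tsub_pos_of_lt hL) hL0, half_pos hN0⟩
  have hcN : c < N⁻¹ := (min_le_right _ _).trans_lt (half_lt_self hN0)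
  have hcL : (L:ℝ) * c ≤ L - 1 := by
    have h1 : c ≤ (L - 1) / L := min_le_left _ _
    have h2 : (c:ℝ) ≤ ((L - 1 : ℝ≥0) : ℝ) / L := by exact_mod_cast h1
    rw [NNReal.coe_sub hL.le, le_div_iff₀ (by exact_mod_cast hL0)] at h2
    simpa [mul_comm] using h2
  obtain ⟨s, hs, hap⟩ := hder.approximates_deriv_on_nhds (c := c) (Or.inr hc0)
  obtain ⟨t, hts, hto, hpt⟩ := _root_.mem_nhds_iff.1 hs
  have hap' := hap.mono_set hts
  refine ⟨hap'.toOpenPartialHomeomorph Φ t (Or.inr hcN) hto, ‖v‖⁻¹, by positivity, hpt, ?_, hΦ0⟩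
  intro x hx y hy
  have h2 : ‖Φ x - Φ y - R (x - y)‖ ≤ c * ‖x - y‖ := hap' x hx y hy
  have hLr : (1:ℝ) < L := by exact_mod_cast hL
  have hcr : (0:ℝ) ≤ c := c.2
  have h3 : ‖Φ x - Φ y‖ ≤ ‖Φ x - Φ y - R (x - y)‖ + ‖R (x - y)‖ := by
    simpa using norm_add_le (Φ x - Φ y - R (x - y)) (R (x - y))
  have h4 : ‖R (x - y)‖ ≤ ‖Φ x - Φ y - R (x - y)‖ + ‖Φ x - Φ y‖ := by
    have := norm_sub_le (Φ x - Φ y) (Φ x - Φ y - R (x - y))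
    rw [sub_sub_cancel] at this
    linarith
  rw [hRn] at h3 h4
  have h5 := norm_nonneg (x - y)
  show dist (Φ x) (Φ y) ≤ _ ∧ _ ≤ _ * dist (Φ x) (Φ y)
  rw [dist_eq_norm, dist_eq_norm]
  have hcc : (c:ℝ) ≤ L - 1 := by nlinarith
  constructor
  · nlinarith
  · have : (L:ℝ) * ‖x - y‖ ≤ L * (c * ‖x-y‖ + ‖Φ x - Φ y‖) := by
      gcongr; linarith
    nlinarith

lemma BiL.symm {d : ℕ} {L : ℝ≥0} {e : OpenPartialHomeomorph (Euc d) (Euc d)}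
    (h : BiL L e.source e) : BiL L e.target e.symm := by
  intro x hx y hy
  have := h _ (e.map_target hx) _ (e.map_target hy)
  rw [e.right_inv hx, e.right_inv hy] at this
  exact this.symm

/-- the push-forward of a cutoff by a chart -/
def pushf {d : ℕ} (e : OpenPartialHomeomorph (Euc d) (Euc d)) (χ : Euc d → ℝ≥0∞) : Euc d → ℝ≥0∞ :=
  e.target.indicator (fun y => χ (e.symm y))

lemma continuous_pushf {d : ℕ} {e : OpenPartialHomeomorph (Euc d) (Euc d)} {χ : Euc d → ℝ≥0∞}
    (hc : Continuous χ) {K : Set (Euc d)} (hK : IsCompact K) (hKe : K ⊆ e.source)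
    (hχ : ∀ x, χ x ≠ 0 → x ∈ K) : Continuous (pushf e χ) := by
  rw [continuous_iff_continuousAt]
  intro y
  by_cases hy : y ∈ e.target
  · have : (fun y => χ (e.symm y)) =ᶠ[nhds y] pushf e χ := by
      filter_upwards [e.open_target.mem_nhds hy] with z hz
      rw [pushf, indicator_of_mem hz]
    refine ContinuousAt.congr ?_ this
    exact hc.continuousAt.comp (e.symm.continuousAt hy)
  · have hcl : IsClosed (e '' K) := (hK.image_of_continuousOn (e.continuousOn.mono hKe)).isClosed
    have hyK : y ∈ (e '' K)ᶜ := by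
      rintro ⟨x, hx, rfl⟩
      exact hy (e.map_source (hKe hx))
    have : (fun _ => (0:ℝ≥0∞)) =ᶠ[nhds y] pushf e χ := by
      filter_upwards [hcl.isOpen_compl.mem_nhds hyK] with z hz
      rw [pushf]
      by_cases hzt : z ∈ e.target
      · rw [indicator_of_mem hzt]
        by_contra h
        exact hz ⟨e.symm z, hχ _ (Ne.symm h), e.right_inv hzt⟩
      · rw [indicator_of_notMem hzt]
    exact continuousAt_const.congr this


/-! Local sandwich -/

def Sand {d : ℕ} (C : ℝ≥0∞) (E : Set (Euc d)) (χ : Euc d → ℝ≥0∞) (K : ℝ≥0∞) : Prop :=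
  ∃ (u l : ℝ → ℝ≥0∞) (a b : ℝ≥0∞),
    (∀ᶠ ρ in nhdsWithin (0:ℝ) (Ioi 0), AA d E χ ρ / ENNReal.ofReal ρ ^ (d+1) ≤ u ρ) ∧
    Tendsto u (nhdsWithin (0:ℝ) (Ioi 0)) (nhds a) ∧ a ≤ C * K ∧
    (∀ᶠ ρ in nhdsWithin (0:ℝ) (Ioi 0), l ρ ≤ C * (AA d E χ ρ / ENNReal.ofReal ρ ^ (d+1))) ∧
    Tendsto l (nhdsWithin (0:ℝ) (Ioi 0)) (nhds b) ∧ K ≤ C * b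

lemma div_scale {L : ℝ≥0} (hL : 0 < L) {ρ : ℝ} (m : ℕ) (X : ℝ≥0∞) :
    X / ENNReal.ofReal ρ ^ m = (L : ℝ≥0∞) ^ m * (X / ENNReal.ofReal (L * ρ) ^ m) := by
  have h0 : (L : ℝ≥0∞) ^ m ≠ 0 := pow_ne_zero _ (by exact_mod_cast hL.ne')
  have ht : (L : ℝ≥0∞) ^ m ≠ ∞ := ENNReal.pow_ne_top ENNReal.coe_ne_top
  rw [ENNReal.ofReal_mul (NNReal.coe_nonneg L), ENNReal.ofReal_coe_nnreal, mul_pow, div_eq_mul_inv, div_eq_mul_inv,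
    ENNReal.mul_inv (Or.inl h0) (Or.inl ht), mul_left_comm X, ← mul_assoc,
    ENNReal.mul_inv_cancel h0 ht, one_mul]

lemma tendsto_scale {c : ℝ} (hc : 0 < c) :
    Tendsto (fun ρ : ℝ => c * ρ) (nhdsWithin (0:ℝ) (Ioi 0)) (nhdsWithin (0:ℝ) (Ioi 0)) := by
  apply tendsto_nhdsWithin_of_tendsto_nhds_of_eventually_within
  · have : Tendsto (fun ρ : ℝ => c * ρ) (nhds 0) (nhds (c * 0)) :=
      (continuous_const.mul continuous_id).tendsto 0
    rw [mul_zero] at this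
    exact this.mono_left nhdsWithin_le_nhds
  · filter_upwards [self_mem_nhdsWithin] with ρ hρ
    exact mul_pos hc hρ

lemma evt_small {δ : ℝ} (hδ : 0 < δ) : ∀ᶠ ρ in nhdsWithin (0:ℝ) (Ioi 0), 0 < ρ ∧ ρ ≤ δ := by
  filter_upwards [Ioc_mem_nhdsGT hδ] with ρ hρ using hρ

theorem local_sand {k : ℕ} {f : Euc (k+1) → ℝ} (hf : Continuous f) {E : Set (Euc (k+1))}
    (hE : E = {x | f x < 0}) (hfr : frontier E = {x | f x = 0})
    {e : OpenPartialHomeomorph (Euc (k+1)) (Euc (k+1))} {c : ℝ} (hc : 0 < c)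
    {L : ℝ≥0} (hL : 1 ≤ L) (hbi : BiL L e.source e) (he : ∀ x, e x 0 = c * f x)
    {χ : Euc (k+1) → ℝ≥0∞} (hχ : Continuous χ) (hχ1 : ∀ x, χ x ≤ 1)
    {K : Set (Euc (k+1))} (hK : IsCompact K) (hKe : K ⊆ e.source) (hχK : ∀ x, χ x ≠ 0 → x ∈ K) :
    Sand ((L : ℝ≥0∞) ^ (3 * (k+1) + 1 + k)) E χ
      (ENNReal.ofReal (omegaB k / ((k:ℝ) + 2)) * ∫⁻ x in frontier E, χ x ∂(Hstd (k+1) k)) := by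
  have hL0 : 0 < L := zero_lt_one.trans_le hL
  have hLr : (0:ℝ) < L := by exact_mod_cast hL0
  have hL1 : (1 : ℝ≥0∞) ≤ (L : ℝ≥0∞) := by exact_mod_cast hL
  have hbs := hbi.symm
  have hmE : MeasurableSet E := by
    rw [hE]; exact (isOpen_lt hf continuous_const).measurableSet
  have hmH : MeasurableSet (Hm k) :=
    measurableSet_lt (f := fun z : Euc (k+1) => z 0) (g := fun _ => (0:ℝ)) (by fun_prop) (by fun_prop)
  have hmP : MeasurableSet {z : Euc (k+1) | z 0 = 0} :=
    measurableSet_eq_fun (f := fun z : Euc (k+1) => z 0) (g := fun _ => (0:ℝ)) (by fun_prop) (by fun_prop)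
  have hmF : MeasurableSet (frontier E) := isClosed_frontier.measurableSet
  have hEe : ∀ x, (x ∈ E ↔ e x ∈ Hm k) := by
    intro x
    rw [hE]
    show f x < 0 ↔ e x 0 < 0
    rw [he]
    constructor
    · intro h; exact mul_neg_of_pos_of_neg hc h
    · intro h; by_contra h2
      exact absurd (mul_nonneg hc.le (not_lt.1 h2)) (not_le.2 h)
  have hFe : ∀ x, (x ∈ frontier E ↔ e x 0 = 0) := by
    intro x
    rw [hfr, he]
    show f x = 0 ↔ _
    simp [hc.ne']
  set ψ := pushf e χ with hψ
  have hψc : Continuous ψ := continuous_pushf hχ hK hKe hχK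
  have hψ1 : ∀ y, ψ y ≤ 1 := by
    intro y
    rw [hψ, pushf]
    by_cases hy : y ∈ e.target
    · rw [indicator_of_mem hy]; exact hχ1 _
    · rw [indicator_of_notMem hy]; exact zero_le
  have hK' : IsCompact (e '' K) := hK.image_of_continuousOn (e.continuousOn.mono hKe)
  have hK't : e '' K ⊆ e.target := by
    rintro _ ⟨x, hx, rfl⟩
    exact e.map_source (hKe hx)
  have hψK : ∀ y, ψ y ≠ 0 → y ∈ e '' K := by
    intro y hy
    rw [hψ, pushf] at hy
    by_cases hyt : y ∈ e.target
    · rw [indicator_of_mem hyt] at hy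
      exact ⟨e.symm y, hχK _ hy, e.right_inv hyt⟩
    · rw [indicator_of_notMem hyt] at hy
      exact absurd rfl hy
  have hχψ : ∀ x ∈ e.source, χ x = ψ (e x) := by
    intro x hx
    rw [hψ, pushf, indicator_of_mem (e.map_source hx), e.left_inv hx]
  have hψχ : ∀ y ∈ e.target, ψ y = χ (e.symm y) := by
    intro y hy
    rw [hψ, pushf, indicator_of_mem hy]
  obtain ⟨R, hR⟩ := hK'.isBounded.exists_norm_le
  have hflat := flat_lim hψc hψ1 (R := R) (fun y hy => hR y (hψK y hy))
  obtain ⟨δ, hδ, hδs⟩ := hK.exists_cthickening_subset_open e.open_source hKe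
  obtain ⟨δ', hδ', hδs'⟩ := hK'.exists_cthickening_subset_open e.open_target hK't
  set κ := ENNReal.ofReal (omegaB k / ((k:ℝ) + 2))
  set Iψ := ∫⁻ z in {z | z 0 = 0}, ψ z ∂(Hstd (k+1) k) with hIψ
  set Iχ := ∫⁻ x in frontier E, χ x ∂(Hstd (k+1) k) with hIχ
  have hI1 : Iχ ≤ (L : ℝ≥0∞) ^ k * Iψ := by
    have h1 : Iχ = ∫⁻ x in frontier E ∩ e.source, ψ (e x) ∂(Hstd (k+1) k) := by
      rw [hIχ, ← lintegral_indicator hmF, ← lintegral_indicator (hmF.inter e.open_source.measurableSet)]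
      congr 1
      ext x
      by_cases hx : x ∈ e.source
      · by_cases hxF : x ∈ frontier E <;> simp [indicator, hx, hxF, hχψ]
      · have : χ x = 0 := by
          by_contra h; exact hx (hKe (hχK x h))
        simp [indicator, hx, this]
    rw [h1]
    exact hbi.lint_le k inter_subset_right (hmF.inter e.open_source.measurableSet)
      (fun x hx => (hFe x).1 hx.1) hψc.measurable
  have hI2 : Iψ ≤ (L : ℝ≥0∞) ^ k * Iχ := by
    have h1 : Iψ = ∫⁻ x in {z | z 0 = 0} ∩ e.target, χ (e.symm x) ∂(Hstd (k+1) k) := by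
      rw [hIψ, ← lintegral_indicator hmP, ← lintegral_indicator (hmP.inter e.open_target.measurableSet)]
      congr 1
      ext x
      by_cases hx : x ∈ e.target
      · by_cases hxF : x 0 = 0 <;> simp [indicator, hx, hxF, hψχ]
      · have : ψ x = 0 := by
          by_contra h; exact hx (hK't (hψK x h))
        simp [indicator, hx, this]
    rw [h1]
    refine hbs.lint_le k inter_subset_right (hmP.inter e.open_target.measurableSet)
      (fun y hy => (hFe _).2 ?_) hχ.measurable
    rw [e.right_inv hy.2]; exact hy.1
  refine ⟨fun ρ => (L : ℝ≥0∞) ^ (3*(k+1)+1) *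
      (AA (k+1) (Hm k) ψ (L * ρ) / ENNReal.ofReal (L * ρ) ^ (k+1+1)),
    fun ρ => AA (k+1) (Hm k) ψ ((L:ℝ)⁻¹ * ρ) / ENNReal.ofReal ((L:ℝ)⁻¹ * ρ) ^ (k+1+1),
    (L : ℝ≥0∞) ^ (3*(k+1)+1) * (κ * Iψ), κ * Iψ, ?_, ?_, ?_, ?_, ?_, ?_⟩
  · filter_upwards [evt_small hδ] with ρ hρ
    have h1 := hbi.AA_le e.open_source.measurableSet hmE hmH (fun x _ => hEe x) hψc.measurable
      hχψ hρ.1.le (fun x hx => (closedBall_subset_cthickening (hχK x hx) ρ).trans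
        ((cthickening_mono hρ.2 K).trans hδs))
    rw [div_scale hL0 (k+1+1) (AA (k+1) E χ ρ), show 3*(k+1)+1 = (k+1+1) + 2*(k+1) by ring,
      pow_add _ (k+1+1) (2*(k+1)), mul_assoc]
    refine mul_le_mul' le_rfl ?_
    rw [← mul_div_assoc]
    gcongr
  · exact ENNReal.Tendsto.const_mul (hflat.comp (tendsto_scale hLr))
      (Or.inr (ENNReal.pow_ne_top ENNReal.coe_ne_top))
  · rw [pow_add _ (3*(k+1)+1) k, mul_assoc]
    refine mul_le_mul' le_rfl ?_
    rw [mul_left_comm]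
    exact mul_le_mul' le_rfl hI2
  · have hsm := (tendsto_scale (inv_pos.2 hLr)).eventually (evt_small hδ')
    filter_upwards [hsm, self_mem_nhdsWithin] with ρ hρ hρ0
    have h1 := hbs.AA_le (E1 := Hm k) (E2 := E) (χ := ψ) (ψ := χ) (ρ := (L:ℝ)⁻¹ * ρ)
      e.open_target.measurableSet hmH hmE
      (fun y hy => by
        have h : (e.symm y ∈ E ↔ e (e.symm y) ∈ Hm k) := hEe (e.symm y)
        rw [e.right_inv hy] at h; exact h.symm) hχ.measurable
      hψχ hρ.1.le (fun x hx => (closedBall_subset_cthickening (hψK x hx) _).trans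
        ((cthickening_mono hρ.2 _).trans hδs'))
    rw [div_scale hL0 (k+1+1) (AA (k+1) (Hm k) ψ _), mul_inv_cancel_left₀ hLr.ne']
    rw [mul_inv_cancel_left₀ hLr.ne'] at h1
    calc _ ≤ (L : ℝ≥0∞) ^ (k+1+1) * (((L : ℝ≥0∞) ^ (2*(k+1)) * AA (k+1) E χ ρ) /
            ENNReal.ofReal ρ ^ (k+1+1)) := by gcongr
      _ = (L : ℝ≥0∞) ^ (3*(k+1)+1) * (AA (k+1) E χ ρ / ENNReal.ofReal ρ ^ (k+1+1)) := by
          rw [show 3*(k+1)+1 = (k+1+1) + 2*(k+1) by ring, pow_add _ (k+1+1), mul_assoc, mul_div_assoc]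
      _ ≤ _ := by
          gcongr ?_ * _
          exact pow_le_pow_right₀ hL1 (by omega)
  · exact hflat.comp (tendsto_scale (inv_pos.2 hLr))
  · calc κ * Iχ ≤ κ * ((L : ℝ≥0∞) ^ k * Iψ) := by gcongr
      _ = (L : ℝ≥0∞) ^ k * (κ * Iψ) := by rw [mul_left_comm]
      _ ≤ _ := by
          gcongr ?_ * _
          exact pow_le_pow_right₀ hL1 (by omega)


/-! Globalization -/

lemma AA_sum {d : ℕ} {ι : Type*} [Fintype ι] (E : Set (Euc d)) (χ : ι → Euc d → ℝ≥0∞)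
    (hE : MeasurableSet E) (hχ : ∀ i, Measurable (χ i)) (ρ : ℝ) :
    AA d E (fun x => ∑ i, χ i x) ρ = ∑ i, AA d E (χ i) ρ := by
  unfold AA
  rw [← lintegral_finsetSum]
  · simp_rw [Finset.sum_mul]
  · intro i _
    exact (hχ i).mul (measurable_AAint hE ρ)

lemma Sand.sum {d : ℕ} {ι : Type*} [Fintype ι] {E : Set (Euc d)} {χ : ι → Euc d → ℝ≥0∞}
    {C : ℝ≥0∞} {K : ι → ℝ≥0∞}
    (hE : MeasurableSet E) (hχ : ∀ i, Measurable (χ i)) (h : ∀ i, Sand C E (χ i) (K i)) :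
    Sand C E (fun x => ∑ i, χ i x) (∑ i, K i) := by
  choose u l a b h1 h2 h3 h4 h5 h6 using h
  have hdiv : ∀ ρ, AA d E (fun x => ∑ i, χ i x) ρ / ENNReal.ofReal ρ ^ (d+1) =
      ∑ i, AA d E (χ i) ρ / ENNReal.ofReal ρ ^ (d+1) := by
    intro ρ
    rw [AA_sum E χ hE hχ]
    simp_rw [div_eq_mul_inv]
    rw [Finset.sum_mul]
  refine ⟨fun ρ => ∑ i, u i ρ, fun ρ => ∑ i, l i ρ, ∑ i, a i, ∑ i, b i, ?_, ?_, ?_, ?_, ?_, ?_⟩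
  · filter_upwards [eventually_all.2 h1] with ρ hρ
    rw [hdiv]
    exact Finset.sum_le_sum fun i _ => hρ i
  · exact tendsto_finsetSum _ fun i _ => h2 i
  · rw [Finset.mul_sum]
    exact Finset.sum_le_sum fun i _ => h3 i
  · filter_upwards [eventually_all.2 h4] with ρ hρ
    rw [hdiv, Finset.mul_sum]
    exact Finset.sum_le_sum fun i _ => hρ i
  · exact tendsto_finsetSum _ fun i _ => h5 i
  · rw [Finset.mul_sum]
    exact Finset.sum_le_sum fun i _ => h6 i

lemma pow_tends (N : ℕ) (m : ℝ≥0∞) (hm : m ≠ ∞) :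
    Tendsto (fun L : ℝ≥0 => (L : ℝ≥0∞) ^ N * m) (nhdsWithin 1 (Ioi 1)) (nhds m) := by
  have h1 : Tendsto (fun L : ℝ≥0 => ((L ^ N : ℝ≥0) : ℝ≥0∞)) (nhds 1) (nhds ((1 ^ N : ℝ≥0) : ℝ≥0∞)) :=
    (ENNReal.continuous_coe.comp (continuous_pow N)).tendsto 1
  have h2 := (ENNReal.Tendsto.mul_const (b := m) h1 (Or.inr hm)).mono_left
    (nhdsWithin_le_nhds (s := Ioi (1:ℝ≥0)))
  simpa using h2

lemma sand_lim {d : ℕ} {E : Set (Euc d)} {χ : Euc d → ℝ≥0∞} {K : ℝ≥0∞} (N : ℕ)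
    (h : ∀ L : ℝ≥0, 1 < L → Sand ((L : ℝ≥0∞) ^ N) E χ K) :
    Tendsto (fun ρ => AA d E χ ρ / ENNReal.ofReal ρ ^ (d+1)) (nhdsWithin 0 (Ioi 0)) (nhds K) := by
  rw [tendsto_order]
  constructor
  · intro m hm
    have h1 := (pow_tends (N + N) m hm.ne_top).eventually_lt_const hm
    obtain ⟨L, hL, hL1⟩ := (h1.and self_mem_nhdsWithin).exists
    obtain ⟨u, l, a, b, -, -, -, h4, h5, h6⟩ := h L hL1
    have hb : (L : ℝ≥0∞) ^ N * m < b := by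
      by_contra hb
      rw [not_lt] at hb
      have : K ≤ (L : ℝ≥0∞) ^ (N + N) * m := by
        rw [pow_add, mul_assoc]
        exact h6.trans (mul_le_mul' le_rfl hb)
      exact absurd hL (not_lt.2 this)
    filter_upwards [h4, h5.eventually_const_lt hb] with ρ h7 h8
    by_contra h9
    exact absurd (h8.trans_le h7) (not_lt.2 (mul_le_mul' le_rfl (not_lt.1 h9)))
  · intro m hm
    have h1 := (pow_tends N K hm.ne_top).eventually_lt_const hm
    obtain ⟨L, hL, hL1⟩ := (h1.and self_mem_nhdsWithin).exists
    obtain ⟨u, l, a, b, h1, h2, h3, -⟩ := h L hL1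
    filter_upwards [h1, h2.eventually_lt_const (h3.trans_lt hL)] with ρ h7 h8
    exact h7.trans_lt h8

lemma Sand.congr {d : ℕ} {C : ℝ≥0∞} {E : Set (Euc d)} {χ χ' : Euc d → ℝ≥0∞} {K : ℝ≥0∞}
    (h : Sand C E χ K)
    (hc : ∀ᶠ ρ in nhdsWithin (0:ℝ) (Ioi 0), AA d E χ ρ = AA d E χ' ρ) : Sand C E χ' K := by
  obtain ⟨u, l, a, b, h1, h2, h3, h4, h5, h6⟩ := h
  refine ⟨u, l, a, b, ?_, h2, h3, ?_, h5, h6⟩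
  · filter_upwards [h1, hc] with ρ h hρ
    rwa [← hρ]
  · filter_upwards [h4, hc] with ρ h hρ
    rwa [← hρ]

theorem global_sand {k : ℕ} {E : Set (Euc (k+1))} (hE : BddC2Domain (k+1) E) {L : ℝ≥0} (hL : 1 < L) :
    Sand ((L : ℝ≥0∞) ^ (3 * (k+1) + 1 + k)) E 1
      (ENNReal.ofReal (omegaB k / ((k:ℝ) + 2)) * Hstd (k+1) k (frontier E)) := by
  obtain ⟨f, hf, hEf, hfr, hdf⟩ := hE.defining
  have hmE : MeasurableSet E := hE.isOpen.measurableSet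
  have hcpt : IsCompact (frontier E) :=
    Metric.isCompact_of_isClosed_isBounded isClosed_frontier
      (hE.bounded.closure.subset frontier_subset_closure)
  have hch : ∀ p : frontier E, ∃ (e : OpenPartialHomeomorph (Euc (k+1)) (Euc (k+1))) (c : ℝ), 0 < c ∧
      (p : Euc (k+1)) ∈ e.source ∧ BiL L e.source e ∧ ∀ x, e x 0 = c * f x :=
    fun p => exists_chart hf (hdf p p.2) hL
  choose e c hc hp hbi he using hch
  set U : frontier E → Set (Euc (k+1)) := fun p => (e p).source ∩ ball p 1 with hU
  have hUo : ∀ p, IsOpen (U p) := fun p => (e p).open_source.inter isOpen_ball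
  obtain ⟨t, ht⟩ := hcpt.elim_finite_subcover U hUo
    (fun p hpF => mem_iUnion.2 ⟨⟨p, hpF⟩, hp ⟨p, hpF⟩, mem_ball_self one_pos⟩)
  have hVo : IsOpen (⋃ i ∈ t, U i) := isOpen_biUnion fun i _ => hUo i
  obtain ⟨δ, hδ, hδs⟩ := hcpt.exists_cthickening_subset_open hVo ht
  obtain ⟨g, hg⟩ := PartitionOfUnity.exists_isSubordinate (ι := t)
    (isClosed_cthickening (E := frontier E) (δ := δ)) (fun i => U i) (fun i => hUo i)
    (hδs.trans (by
      intro x hx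
      simp only [mem_iUnion] at hx ⊢
      obtain ⟨i, hi, hx⟩ := hx
      exact ⟨⟨i, hi⟩, hx⟩))
  set χ : t → Euc (k+1) → ℝ≥0∞ := fun i x => ENNReal.ofReal (g i x) with hχ
  have hχc : ∀ i, Continuous (χ i) := fun i => ENNReal.continuous_ofReal.comp (g i).continuous
  have hsum : ∀ x ∈ cthickening δ (frontier E), ∑ i, χ i x = 1 := by
    intro x hx
    rw [hχ, ← ENNReal.ofReal_sum_of_nonneg (fun i _ => g.nonneg i x), ← finsum_eq_sum_of_fintype,
      g.sum_eq_one hx, ENNReal.ofReal_one]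
  have hloc : ∀ i, Sand ((L : ℝ≥0∞) ^ (3 * (k+1) + 1 + k)) E (χ i)
      (ENNReal.ofReal (omegaB k / ((k:ℝ) + 2)) * ∫⁻ x in frontier E, χ i x ∂(Hstd (k+1) k)) := by
    intro i
    have hts : tsupport (g i) ⊆ U i := hg i
    refine local_sand hf.continuous hEf hfr (hc i) hL.le (hbi i) (he i) (hχc i) ?_
      (K := tsupport (g i)) ?_ (hts.trans inter_subset_left) ?_
    · intro x
      exact ENNReal.ofReal_le_one.2 (g.le_one i x)
    · exact Metric.isCompact_of_isClosed_isBounded (isClosed_tsupport _)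
        (isBounded_ball.subset (hts.trans inter_subset_right))
    · intro x hx
      apply subset_tsupport
      intro h0
      exact hx (by rw [hχ]; simp [h0])
  have hs := Sand.sum hmE (fun i => (hχc i).measurable) hloc
  rw [← Finset.mul_sum, ← lintegral_finsetSum _ (fun i _ => (hχc i).measurable)] at hs
  have hI : ∫⁻ x in frontier E, ∑ i, χ i x ∂(Hstd (k+1) k) = Hstd (k+1) k (frontier E) := by
    rw [setLIntegral_congr_fun isClosed_frontier.measurableSet
      (fun x hx => hsum x (self_subset_cthickening _ hx)), setLIntegral_one]
  rw [hI] at hs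
  refine hs.congr ?_
  filter_upwards [evt_small hδ] with ρ hρ
  apply setLIntegral_congr_fun hmE
  intro x hx
  by_cases hne : (Eᶜ ∩ closedBall x ρ).Nonempty
  · obtain ⟨y, hy, hyb⟩ := hne
    have hcon : IsPreconnected (closedBall x ρ) := (convex_closedBall x ρ).isPreconnected
    have hfx : f x < 0 := by rw [hEf] at hx; exact hx
    have hfy : 0 ≤ f y := by
      rw [hEf] at hy; exact not_lt.1 hy
    obtain ⟨z, hz, hz0⟩ := hcon.intermediate_value (mem_closedBall_self hρ.1.le) hyb
      hf.continuous.continuousOn ⟨hfx.le, hfy⟩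
    have hzF : z ∈ frontier E := by rw [hfr]; exact hz0
    have hxc : x ∈ cthickening δ (frontier E) := by
      apply mem_cthickening_of_dist_le x z δ _ hzF
      rw [dist_comm]
      exact hz.trans hρ.2
    simp only [hsum x hxc, Pi.one_apply]
  · rw [not_nonempty_iff_eq_empty] at hne
    simp [hne]

theorem main_aux {k : ℕ} {E : Set (Euc (k+1))} (hE : BddC2Domain (k+1) E) :
    Tendsto (fun r : ℝ => Jt (k+1) 1 r E / ENNReal.ofReal (sgm (k+1) 1 r))
      (nhdsWithin 0 (Set.Ioi 0))
      (nhds (ENNReal.ofReal (omegaB k) * Hstd (k+1) k (frontier E))) := by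
  have h1 := sand_lim _ (fun L hL => global_sand hE (L := L) hL)
  have h2 := Jt_lim (k+1) hE.isOpen.measurableSet hE.bounded.measure_lt_top.ne h1
  have h3 : ENNReal.ofReal (((k+1 : ℕ) : ℝ) + 1) * (ENNReal.ofReal (omegaB k / ((k:ℝ) + 2)) *
      Hstd (k+1) k (frontier E)) = ENNReal.ofReal (omegaB k) * Hstd (k+1) k (frontier E) := by
    rw [← mul_assoc, ← ENNReal.ofReal_mul (by positivity)]
    congr 2
    push_cast
    field_simp
    ring
  rw [h3] at h2
  exact h2

/-- For `d ≥ 2` and `E ⊆ ℝ^d` a bounded open set with compact `C²` boundary,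
`J̃_r^1(E)/|log r| → ω_{d-1}·H^{d-1}(∂E)` as `r → 0⁺`. -/
theorem stmt1 (d : ℕ) (hd : 2 ≤ d) (E : Set (Euc d)) (hE : BddC2Domain d E) :
    Tendsto (fun r : ℝ => Jt d 1 r E / ENNReal.ofReal (sgm d 1 r))
      (nhdsWithin 0 (Set.Ioi 0))
      (nhds (ENNReal.ofReal (omegaB (d - 1)) * Hstd d (d - 1) (frontier E))) := by
  obtain ⟨k, rfl⟩ : ∃ k, d = k + 1 := ⟨d - 1, by omega⟩
  exact main_aux hE


end
end
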